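/- arXiv:math/9402205 — 3 statements merged into one kernel-verified Lean document; each statement's English description precedes it below -/
import Mathlib

section
/- Suppose X₁ and X₂ are Banach spaces such that X₁ is isomorphic to a complemented subspace of X₂, X₂ is isomorphic to a complemented subspace of X₁, and for some 1 ≤ p ≤ ∞ the space X₁ is isomorphic to the ℓp-sum (Σ ⊕ X₁)_p of countably many copies of itself. Then X₁ is isomorphic to X₂. -/
open scoped ENNReal

noncomputable section

/-- Two normed spaces are isomorphic (linearly homeomorphic). -/
def IsoBanach (X Y : Type*) [NormedAddCommGroup X] [NormedSpace ℝ X]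
    [NormedAddCommGroup Y] [NormedSpace ℝ Y] : Prop :=
  Nonempty (X ≃L[ℝ] Y)

/-- `X` is isomorphic to a complemented subspace of `Y`: there are bounded linear maps
`f : X → Y` and `g : Y → X` with `g ∘ f = id` (so `f ∘ g` is a bounded projection of `Y`
onto a subspace isomorphic to `X`). -/
def ComplementablyEmbedsIn (X Y : Type*) [NormedAddCommGroup X] [NormedSpace ℝ X]
    [NormedAddCommGroup Y] [NormedSpace ℝ Y] : Prop :=
  ∃ (f : X →L[ℝ] Y) (g : Y →L[ℝ] X), g.comp f = ContinuousLinearMap.id ℝ X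

/-- `X` embeds isomorphically into `Y`: a bounded linear map bounded below (hence an
isomorphism onto its closed image). -/
def EmbedsIn (X Y : Type*) [NormedAddCommGroup X] [NormedSpace ℝ X]
    [NormedAddCommGroup Y] [NormedSpace ℝ Y] : Prop :=
  ∃ f : X →L[ℝ] Y, ∃ c : ℝ, 0 < c ∧ ∀ x, c * ‖x‖ ≤ ‖f x‖

theorem memlp_clm {X : Type*} [NormedAddCommGroup X] [NormedSpace ℝ X] {p : ℝ≥0∞}
    (A : X →L[ℝ] X) {u : ℕ → X} (hu : Memℓp (E := fun _ : ℕ => X) u p) :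
    Memℓp (E := fun _ : ℕ => X) (fun n => A (u n)) p := by
  refine Memℓp.mono' (hu.const_smul ‖A‖) fun n => ?_
  simpa [norm_smul] using A.le_opNorm (u n)

theorem memlp_tail {X : Type*} [NormedAddCommGroup X] {p : ℝ≥0∞} [hp : Fact (1 ≤ p)]
    {u : ℕ → X} :
    Memℓp (E := fun _ : ℕ => X) (fun n => u (n + 1)) p ↔ Memℓp (E := fun _ : ℕ => X) u p := by
  rcases p.trichotomy with (rfl | rfl | h)
  · exact absurd hp.out (by simp)
  · rw [memℓp_infty_iff, memℓp_infty_iff]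
    constructor
    · rintro ⟨C, hC⟩
      refine ⟨max ‖u 0‖ C, ?_⟩
      rintro _ ⟨n, rfl⟩
      cases n with
      | zero => exact le_max_left _ _
      | succ n => exact (hC ⟨n, rfl⟩).trans (le_max_right _ _)
    · rintro ⟨C, hC⟩
      refine ⟨C, ?_⟩
      rintro _ ⟨n, rfl⟩
      exact hC ⟨n + 1, rfl⟩
  · rw [memℓp_gen_iff h, memℓp_gen_iff h]
    exact summable_nat_add_iff (f := fun n => ‖u n‖ ^ p.toReal) 1

/-- If `Y` is complemented in `X`, then `lp X` is isomorphic to `Y × lp X`. -/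
theorem lp_absorb {X Y : Type*} [NormedAddCommGroup X] [NormedSpace ℝ X] [CompleteSpace X]
    [NormedAddCommGroup Y] [NormedSpace ℝ Y] [CompleteSpace Y] (p : ℝ≥0∞) [Fact (1 ≤ p)]
    (f : Y →L[ℝ] X) (g : X →L[ℝ] Y) (hgf : ∀ y, g (f y) = y) :
    Nonempty ((Y × lp (fun _ : ℕ => X) p) ≃L[ℝ] lp (fun _ : ℕ => X) p) := by
  let Q : X →L[ℝ] X := ContinuousLinearMap.id ℝ X - f.comp g
  have hQ : ∀ x, Q x = x - f (g x) := fun x => rfl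
  have hm : ∀ a : Y × lp (fun _ : ℕ => X) p, Memℓp (E := fun _ : ℕ => X)
      (fun n => (Nat.casesOn n (f a.1) (fun k => f (g (a.2 k))) : X) + Q (a.2 n)) p := by
    intro a
    have h1 : Memℓp (E := fun _ : ℕ => X)
        (fun n => (Nat.casesOn n (f a.1) (fun k => f (g (a.2 k))) : X)) p := by
      rw [← memlp_tail]
      exact memlp_clm (f.comp g) (u := fun n => a.2 n) (lp.memℓp a.2)
    have h2 : Memℓp (E := fun _ : ℕ => X) (fun n => Q (a.2 n)) p :=
      memlp_clm Q (u := fun n => a.2 n) (lp.memℓp a.2)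
    exact h1.add h2
  have hm' : ∀ v : lp (fun _ : ℕ => X) p, Memℓp (E := fun _ : ℕ => X)
      (fun n => f (g (v (n + 1))) + Q (v n)) p := by
    intro v
    have h0 : Memℓp (E := fun _ : ℕ => X) (fun n => v n) p := lp.memℓp v
    have h1 : Memℓp (E := fun _ : ℕ => X) (fun n => f (g (v (n + 1)))) p :=
      memlp_clm (f.comp g) (u := fun n => v (n + 1)) (memlp_tail.2 h0)
    have h2 : Memℓp (E := fun _ : ℕ => X) (fun n => Q (v n)) p :=
      memlp_clm Q (u := fun n => v n) h0
    exact h1.add h2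
  let S : (Y × lp (fun _ : ℕ => X) p) ≃ₗ[ℝ] lp (fun _ : ℕ => X) p :=
    { toFun := fun a => ⟨_, hm a⟩
      invFun := fun v => (g (v 0), ⟨_, hm' v⟩)
      map_add' := by
        intro a b
        apply lp.ext
        funext n
        cases n with
        | zero =>
          change f (a.1 + b.1) + Q (a.2 0 + b.2 0)
            = (f a.1 + Q (a.2 0)) + (f b.1 + Q (b.2 0))
          simp only [map_add]
          abel
        | succ n =>
          change f (g (a.2 n + b.2 n)) + Q (a.2 (n + 1) + b.2 (n + 1))
            = (f (g (a.2 n)) + Q (a.2 (n + 1))) + (f (g (b.2 n)) + Q (b.2 (n + 1)))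
          simp only [map_add]
          abel
      map_smul' := by
        intro c a
        apply lp.ext
        funext n
        cases n <;> simp [lp.coeFn_smul]
      left_inv := by
        intro a
        refine Prod.ext ?_ ?_
        · simp [hQ, hgf]
        · apply lp.ext
          funext n
          cases n <;> simp [hQ, hgf]
      right_inv := by
        intro v
        apply lp.ext
        funext n
        cases n <;> simp [hQ, hgf] }
  refine ⟨S.toContinuousLinearEquivOfContinuous ?_⟩
  refine LinearMap.continuous_of_seq_closed_graph S.toLinearMap ?_
  intro u x y hu hy
  apply lp.ext
  funext n
  have h1 := ((lp.evalCLM (𝕜 := ℝ) (fun _ : ℕ => X) p n).continuous.tendsto y).comp hy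
  have hc : Continuous fun a : Y × lp (fun _ : ℕ => X) p => S a n := by
    have he : ∀ k, Continuous fun a : Y × lp (fun _ : ℕ => X) p => a.2 k := fun k =>
      (lp.evalCLM (𝕜 := ℝ) (fun _ : ℕ => X) p k).continuous.comp continuous_snd
    cases n with
    | zero => exact (f.continuous.comp continuous_fst).add (Q.continuous.comp (he 0))
    | succ k =>
      exact ((f.comp g).continuous.comp (he k)).add (Q.continuous.comp (he (k + 1)))
  exact tendsto_nhds_unique h1 ((hc.tendsto x).comp hu)

/-- Pełczyński's decomposition method. If `X₁` and `X₂` are Banach spaces,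
each isomorphic to a complemented subspace of the other, and `X₁` is isomorphic to the
`ℓ_p`-sum of countably many copies of itself for some `1 ≤ p ≤ ∞`, then `X₁ ≅ X₂`. -/
theorem stmt1 (X₁ X₂ : Type*) [NormedAddCommGroup X₁] [NormedSpace ℝ X₁] [CompleteSpace X₁]
    [NormedAddCommGroup X₂] [NormedSpace ℝ X₂] [CompleteSpace X₂]
    (h₁ : ComplementablyEmbedsIn X₁ X₂) (h₂ : ComplementablyEmbedsIn X₂ X₁)
    (p : ℝ≥0∞) [Fact (1 ≤ p)]
    (hsum : IsoBanach X₁ (lp (fun _ : ℕ => X₁) p)) :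
    IsoBanach X₁ X₂ := by
  obtain ⟨f, g, hgf⟩ := h₁
  obtain ⟨f', g', hgf'⟩ := h₂
  obtain ⟨e⟩ := hsum
  have hgf : ∀ y, g (f y) = y := fun y => DFunLike.congr_fun hgf y
  have hgf' : ∀ y, g' (f' y) = y := fun y => DFunLike.congr_fun hgf' y
  obtain ⟨a⟩ := lp_absorb p f' g' hgf'
  obtain ⟨b⟩ := lp_absorb p (ContinuousLinearMap.id ℝ X₁) (ContinuousLinearMap.id ℝ X₁)
    (fun _ => rfl)
  let α : (X₂ × X₁) ≃L[ℝ] X₁ :=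
    (((ContinuousLinearEquiv.refl ℝ X₂).prodCongr e).trans a).trans e.symm
  let ψ : (X₁ × X₁) ≃L[ℝ] X₁ :=
    (((ContinuousLinearEquiv.refl ℝ X₁).prodCongr e).trans b).trans e.symm
  let β : (X₁ × X₂) ≃L[ℝ] X₂ := ContinuousLinearEquiv.equivOfInverse
    (f.comp ((ψ : (X₁ × X₁) →L[ℝ] X₁).comp ((ContinuousLinearMap.fst ℝ X₁ X₂).prod
        (g.comp (ContinuousLinearMap.snd ℝ X₁ X₂))))
      + (ContinuousLinearMap.id ℝ X₂ - f.comp g).comp (ContinuousLinearMap.snd ℝ X₁ X₂))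
    (((ContinuousLinearMap.fst ℝ X₁ X₁).comp
        ((ψ.symm : X₁ →L[ℝ] (X₁ × X₁)).comp g)).prod
      (f.comp ((ContinuousLinearMap.snd ℝ X₁ X₁).comp
        ((ψ.symm : X₁ →L[ℝ] (X₁ × X₁)).comp g))
        + (ContinuousLinearMap.id ℝ X₂ - f.comp g)))
    (by
      rintro ⟨x, y⟩
      simp [hgf, -ContinuousLinearEquiv.trans_apply])
    (by
      intro y
      simp [hgf])
  exact ⟨α.symm.trans ((ContinuousLinearEquiv.prodComm ℝ X₂ X₁).trans β)⟩
end
end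

section
/- Let 1 < p, q < ∞. The main triangular projection on ℓ_p ⊗̂ ℓ_q, i.e., the linear map determined on basis elements by e_i ⊗ e_j ↦ e_i ⊗ e_j if i ≤ j and e_i ⊗ e_j ↦ 0 if i > j, extends to a bounded operator on ℓ_p ⊗̂ ℓ_q if and only if 1/p + 1/q > 1. -/
open scoped TensorProduct ENNReal
open PiTensorProduct

noncomputable section

variable (ι : Type*) [Fintype ι] (E : ι → Type*)
  [∀ i, NormedAddCommGroup (E i)] [∀ i, NormedSpace ℝ (E i)]

/-- The projective tensor seminorm on the algebraic tensor product, as a seminormed group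
structure. -/
instance : SeminormedAddCommGroup (⨂[ℝ] i, E i) :=
  (projectiveSeminorm (𝕜 := ℝ) (E := E)).toSeminormedAddCommGroup

instance : NormedSpace ℝ (⨂[ℝ] i, E i) where
  norm_smul_le a x := le_of_eq (map_smul_eq_mul projectiveSeminorm a x)

/-- The (completed) projective tensor product `E 0 ⊗̂ ⋯ ⊗̂ E (N-1)`. -/
abbrev ProjTensor : Type _ := UniformSpace.Completion (⨂[ℝ] i, E i)

variable {ι E} in
/-- The canonical elementary tensor `m 0 ⊗ ⋯ ⊗ m (N-1)` in the completed projective tensor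
product. -/
def tprodC (m : Π i, E i) : ProjTensor ι E :=
  ((⨂ₜ[ℝ] i, m i : ⨂[ℝ] i, E i) : UniformSpace.Completion _)

/-- The space `ℓ_p` of `p`-summable real sequences. -/
abbrev Lp' (p : ℝ≥0∞) : Type := lp (fun _ : ℕ => ℝ) p

/-- The standard unit vector basis of `ℓ_p`. -/
def e' (p : ℝ≥0∞) (n : ℕ) : Lp' p := lp.single p n 1

/-- The completed projective tensor product `ℓ_{p 0} ⊗̂ ⋯ ⊗̂ ℓ_{p (N-1)}`. -/
abbrev LpT {N : ℕ} (p : Fin N → ℝ) [∀ i, Fact (1 ≤ ENNReal.ofReal (p i))] : Type :=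
  ProjTensor (Fin N) (fun i => Lp' (ENNReal.ofReal (p i)))

/-- The basis tensors `e_α = e_{α 0} ⊗ ⋯ ⊗ e_{α (N-1)}` of the projective tensor product of
`ℓ_p`-spaces. -/
def eT {N : ℕ} (p : Fin N → ℝ) [∀ i, Fact (1 ≤ ENNReal.ofReal (p i))] (α : Fin N → ℕ) : LpT p :=
  tprodC (fun i => e' (ENNReal.ofReal (p i)) (α i))


theorem tprodC_norm_le (m : Π i, E i) : ‖tprodC m‖ ≤ ∏ i, ‖m i‖ := by
  unfold tprodC
  exact (UniformSpace.Completion.norm_coe (⨂ₜ[ℝ] i, m i : ⨂[ℝ] i, E i)).le.trans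
    (projectiveSeminorm_tprod_le (𝕜 := ℝ) m)

theorem tprodC_lift {F : Type*} [NormedAddCommGroup F] [NormedSpace ℝ F] [CompleteSpace F]
    (B : MultilinearMap ℝ E F) (C : ℝ) (hC : 0 ≤ C) (hB : ∀ m, ‖B m‖ ≤ C * ∏ i, ‖m i‖) :
    ∃ L : ProjTensor ι E →L[ℝ] F, (∀ m, L (tprodC m) = B m) ∧ ∀ z, ‖L z‖ ≤ C * ‖z‖ := by
  set f := B.mkContinuous C hB
  let l : (⨂[ℝ] i, E i) →L[ℝ] F := LinearMap.mkContinuous (lift B) C (fun x => by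
    refine (norm_eval_le_projectiveSeminorm f x).trans ?_
    exact mul_le_mul_of_nonneg_right (B.mkContinuous_norm_le hC hB) (norm_nonneg _))
  have hl : ∀ x, ‖l x‖ ≤ C * ‖x‖ := fun x => by
    refine (norm_eval_le_projectiveSeminorm f x).trans ?_
    exact mul_le_mul_of_nonneg_right (B.mkContinuous_norm_le hC hB) (norm_nonneg _)
  have hd : DenseRange (UniformSpace.Completion.toComplL (𝕜 := ℝ) (E := ⨂[ℝ] i, E i)) :=
    UniformSpace.Completion.denseRange_coe
  have hu : IsUniformInducing (UniformSpace.Completion.toComplL (𝕜 := ℝ) (E := ⨂[ℝ] i, E i)) :=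
    UniformSpace.Completion.isUniformInducing_coe _
  have he : ∀ x : (⨂[ℝ] i, E i), (l.extend (UniformSpace.Completion.toComplL (𝕜 := ℝ)
      (E := ⨂[ℝ] i, E i))) (x : UniformSpace.Completion _) = l x := fun x =>
    ContinuousLinearMap.extend_eq l hd hu x
  refine ⟨l.extend (UniformSpace.Completion.toComplL (𝕜 := ℝ) (E := ⨂[ℝ] i, E i)), ?_, ?_⟩
  · intro m
    unfold tprodC
    rw [he]
    exact lift.tprod m
  · intro z
    induction z using UniformSpace.Completion.induction_on with
    | hp => exact isClosed_le (by fun_prop) (by fun_prop)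
    | ih x => 
      rw [he]
      exact (hl x).trans (mul_le_mul_of_nonneg_left
        (UniformSpace.Completion.norm_coe x).ge hC)

/-- The elementary tensors as a bilinear map. -/
def tpL (p : Fin 2 → ℝ) [∀ i, Fact (1 ≤ ENNReal.ofReal (p i))] :
    Lp' (ENNReal.ofReal (p 0)) →ₗ[ℝ] Lp' (ENNReal.ofReal (p 1)) →ₗ[ℝ] LpT p :=
  LinearMap.mk₂ ℝ (fun x y => tprodC (E := fun i => Lp' (ENNReal.ofReal (p i)))
    (Fin.cons x (Fin.cons y finZeroElim)))
    (by
      intro x x' y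
      simp only [tprodC]
      rw [MultilinearMap.cons_add, UniformSpace.Completion.coe_add])
    (by
      intro c x y
      simp only [tprodC]
      rw [MultilinearMap.cons_smul, UniformSpace.Completion.coe_smul])
    (by
      intro x y y'
      simp only [tprodC]
      have := (tprod ℝ (s := fun i : Fin 2 => Lp' (ENNReal.ofReal (p i)))).map_update_add
        (Fin.cons x (Fin.cons y finZeroElim)) 1 y y'
      rw [← UniformSpace.Completion.coe_add]
      congr 1
      convert this using 2
      · ext i; fin_cases i <;> rfl
      · congr 1; ext i; fin_cases i <;> rfl
      · congr 1; ext i; fin_cases i <;> rfl)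
    (by
      intro c x y
      simp only [tprodC]
      have := (tprod ℝ (s := fun i : Fin 2 => Lp' (ENNReal.ofReal (p i)))).map_update_smul
        (Fin.cons x (Fin.cons y finZeroElim)) 1 c y
      rw [← UniformSpace.Completion.coe_smul]
      congr 1
      convert this using 2
      · ext i; fin_cases i <;> rfl
      · congr 1; ext i; fin_cases i <;> rfl)

theorem tpL_apply (p : Fin 2 → ℝ) [∀ i, Fact (1 ≤ ENNReal.ofReal (p i))] (x y) :
  tpL p x y = tprodC (E := fun i => Lp' (ENNReal.ofReal (p i)))
    (Fin.cons x (Fin.cons y finZeroElim)) := rfl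

theorem tpL_norm_le (p : Fin 2 → ℝ) [∀ i, Fact (1 ≤ ENNReal.ofReal (p i))] (x y) :
    ‖tpL p x y‖ ≤ ‖x‖ * ‖y‖ := by
  rw [tpL_apply]
  refine (tprodC_norm_le _ _ _).trans (le_of_eq ?_)
  rw [Fin.prod_univ_two]; rfl

theorem eT_eq (p : Fin 2 → ℝ) [∀ i, Fact (1 ≤ ENNReal.ofReal (p i))] (i j : ℕ) :
    eT p ![i, j] = tpL p (e' _ i) (e' _ j) := by
  rw [tpL_apply]
  unfold eT
  congr 1
  ext k; fin_cases k <;> rfl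

theorem tpL_lift (p : Fin 2 → ℝ) [∀ i, Fact (1 ≤ ENNReal.ofReal (p i))]
    {F : Type*} [NormedAddCommGroup F] [NormedSpace ℝ F] [CompleteSpace F]
    (B : Lp' (ENNReal.ofReal (p 0)) →ₗ[ℝ] Lp' (ENNReal.ofReal (p 1)) →ₗ[ℝ] F)
    (C : ℝ) (hC : 0 ≤ C) (hB : ∀ x y, ‖B x y‖ ≤ C * (‖x‖ * ‖y‖)) :
    ∃ L : LpT p →L[ℝ] F, (∀ x y, L (tpL p x y) = B x y) ∧ ∀ z, ‖L z‖ ≤ C * ‖z‖ := by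
  let M : MultilinearMap ℝ (fun i : Fin 2 => Lp' (ENNReal.ofReal (p i))) F :=
    MultilinearMap.mk' (fun m => B (m 0) (m 1))
      (by intro m i x y; fin_cases i <;> simp [Function.update])
      (by intro m i c x; fin_cases i <;> simp [Function.update])
  obtain ⟨L, h1, h2⟩ := tprodC_lift _ _ M C hC (by
    intro m; rw [Fin.prod_univ_two]; exact hB _ _)
  exact ⟨L, fun x y => by rw [tpL_apply, h1]; rfl, h2⟩


/-- restriction of a sequence to the interval `[a, b)`. -/
def segL (P : ℝ≥0∞) [Fact (1 ≤ P)] (a b : ℕ) : Lp' P →ₗ[ℝ] Lp' P where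
  toFun x := ∑ i ∈ Finset.Ico a b, lp.single P i (x i)
  map_add' x y := by
    simp only [lp.coeFn_add, Pi.add_apply, lp.single_add, Finset.sum_add_distrib]
  map_smul' c x := by
    simp only [lp.coeFn_smul, Pi.smul_apply, lp.single_smul, Finset.smul_sum, RingHom.id_apply]

theorem segL_apply (P : ℝ≥0∞) [Fact (1 ≤ P)] (a b : ℕ) (x : Lp' P) :
    segL P a b x = ∑ i ∈ Finset.Ico a b, lp.single P i (x i) := rfl

theorem segL_add (P : ℝ≥0∞) [Fact (1 ≤ P)] {a b c : ℕ} (hab : a ≤ b) (hbc : b ≤ c) (x : Lp' P) :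
    segL P a c x = segL P a b x + segL P b c x := by
  simp only [segL_apply]
  rw [Finset.sum_Ico_consecutive _ hab hbc]

theorem segL_self (P : ℝ≥0∞) [Fact (1 ≤ P)] (a : ℕ) (x : Lp' P) : segL P a a x = 0 := by
  simp [segL_apply]

theorem segL_sum (P : ℝ≥0∞) [Fact (1 ≤ P)] (a b : ℕ) (x : Lp' P) :
    ∑ j ∈ Finset.Ico a b, segL P j (j + 1) x = segL P a b x := by
  simp [segL_apply]

theorem segL_e (P : ℝ≥0∞) [Fact (1 ≤ P)] (a b k : ℕ) :
    segL P a b (e' P k) = if a ≤ k ∧ k < b then e' P k else 0 := by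
  rw [segL_apply]
  have : ∀ i ∈ Finset.Ico a b, lp.single P i ((e' P k : Lp' P) i) =
      if i = k then (e' P k : Lp' P) else 0 := by
    intro i _
    split_ifs with h
    · subst h; simp [e']
    · simp [e', Pi.single_eq_of_ne h]
  rw [Finset.sum_congr rfl this, Finset.sum_ite_eq']
  simp

theorem segL_norm {p : ℝ} [Fact (1 ≤ ENNReal.ofReal p)] (hp : 1 < p) (a b : ℕ)
    (x : Lp' (ENNReal.ofReal p)) :
    ‖segL _ a b x‖ = (∑ i ∈ Finset.Ico a b, |x i| ^ p) ^ (1 / p) := by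
  have hp0 : 0 < p := by linarith
  have hr : (ENNReal.ofReal p).toReal = p := ENNReal.toReal_ofReal hp0.le
  have := lp.norm_sum_single (p := ENNReal.ofReal p) (E := fun _ : ℕ => ℝ) (by rw [hr]; exact hp0)
    x (Finset.Ico a b)
  rw [hr, ← segL_apply] at this
  simp only [Real.norm_eq_abs] at this
  rw [← this, ← Real.rpow_mul (norm_nonneg _), mul_one_div_cancel hp0.ne', Real.rpow_one]

section trunc
variable {p q : ℝ} [Fact (1 ≤ ENNReal.ofReal p)] [Fact (1 ≤ ENNReal.ofReal q)]
  {Z : Type*} [NormedAddCommGroup Z] [NormedSpace ℝ Z]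
  (τ : Lp' (ENNReal.ofReal p) →ₗ[ℝ] Lp' (ENNReal.ofReal q) →ₗ[ℝ] Z)

/-- triangular truncation inside the square `[a, b) × [a, b)`. -/
def triB (a b : ℕ) : Lp' (ENNReal.ofReal p) →ₗ[ℝ] Lp' (ENNReal.ofReal q) →ₗ[ℝ] Z :=
  ∑ j ∈ Finset.Ico a b, τ.compl₁₂ (segL _ a (j + 1)) (segL _ j (j + 1))

theorem triB_apply (a b : ℕ) (x : Lp' (ENNReal.ofReal p)) (y : Lp' (ENNReal.ofReal q)) :
    triB τ a b x y =
      ∑ j ∈ Finset.Ico a b, τ (segL _ a (j + 1) x) (segL _ j (j + 1) y) := by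
  simp [triB, LinearMap.sum_apply]

theorem triB_sub {a b c : ℕ} (hab : a ≤ b) (hbc : b ≤ c)
    (x : Lp' (ENNReal.ofReal p)) (y : Lp' (ENNReal.ofReal q)) :
    triB τ a c x y = triB τ a b x y + τ (segL _ a b x) (segL _ b c y) + triB τ b c x y := by
  simp only [triB_apply]
  rw [← Finset.sum_Ico_consecutive _ hab hbc, add_assoc]
  congr 1
  rw [← segL_sum _ b c y, map_sum, ← Finset.sum_add_distrib]
  apply Finset.sum_congr rfl
  intro j hj
  have := Finset.mem_Ico.1 hj
  rw [segL_add _ hab (by omega : b ≤ j + 1) x, map_add, LinearMap.add_apply]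

theorem triB_split {a b c : ℕ} (hac : a ≤ c) (hcb : c < b)
    (x : Lp' (ENNReal.ofReal p)) (y : Lp' (ENNReal.ofReal q)) :
    triB τ a b x y = triB τ a c x y + τ (segL _ a (c + 1) x) (segL _ c b y) +
      triB τ (c + 1) b x y := by
  rw [triB_sub τ (by omega : a ≤ c + 1) (by omega : c + 1 ≤ b)]
  have : triB τ a (c + 1) x y = triB τ a c x y + τ (segL _ a (c + 1) x) (segL _ c (c + 1) y) := by
    simp only [triB_apply]
    rw [Finset.sum_Ico_succ_top hac]
  rw [this, segL_add _ (by omega : c ≤ c + 1) (by omega : c + 1 ≤ b) y, map_add]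
  abel

/-- the mass of an interval. -/
def triM (x : Lp' (ENNReal.ofReal p)) (y : Lp' (ENNReal.ofReal q)) (a b : ℕ) : ℝ :=
  ∑ i ∈ Finset.Ico a b, (|x i| ^ p + |y i| ^ q)

theorem triM_nonneg (x : Lp' (ENNReal.ofReal p)) (y : Lp' (ENNReal.ofReal q)) (a b : ℕ) :
    0 ≤ triM x y a b := Finset.sum_nonneg (by intros; positivity)

theorem triM_mono (x : Lp' (ENNReal.ofReal p)) (y : Lp' (ENNReal.ofReal q)) {a b c d : ℕ}
    (h1 : a ≤ b) (h2 : c ≤ d) : triM x y b c ≤ triM x y a d :=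
  Finset.sum_le_sum_of_subset_of_nonneg (Finset.Ico_subset_Ico h1 h2) (by intros; positivity)

theorem triM_x (hp : 1 < p) (x : Lp' (ENNReal.ofReal p)) (y : Lp' (ENNReal.ofReal q)) (a b : ℕ) :
    ‖segL _ a b x‖ ≤ triM x y a b ^ (1 / p) := by
  rw [segL_norm hp]
  apply Real.rpow_le_rpow (Finset.sum_nonneg (by intros; positivity)) _ (by positivity)
  apply Finset.sum_le_sum; intro i _
  have : 0 ≤ |y i| ^ q := by positivity
  linarith

theorem triM_y (hq : 1 < q) (x : Lp' (ENNReal.ofReal p)) (y : Lp' (ENNReal.ofReal q)) (a b : ℕ) :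
    ‖segL _ a b y‖ ≤ triM x y a b ^ (1 / q) := by
  rw [segL_norm hq]
  apply Real.rpow_le_rpow (Finset.sum_nonneg (by intros; positivity)) _ (by positivity)
  apply Finset.sum_le_sum; intro i _
  have : 0 ≤ |x i| ^ p := by positivity
  linarith

theorem triM_split (x : Lp' (ENNReal.ofReal p)) (y : Lp' (ENNReal.ofReal q)) (a n : ℕ) :
    ∃ c, a ≤ c ∧ c < a + n + 1 ∧ triM x y a c ≤ triM x y a (a + n + 1) / 2 ∧
      triM x y (c + 1) (a + n + 1) ≤ triM x y a (a + n + 1) / 2 := by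
  classical
  have h0 := triM_nonneg x y a (a + n + 1)
  have hex : ∃ k, triM x y a (a + n + 1) / 2 ≤ triM x y a (a + k + 1) := ⟨n, by linarith⟩
  have hk := Nat.find_spec hex
  have hkn : Nat.find hex ≤ n := Nat.find_min' hex (by linarith)
  have hmin := fun m => Nat.find_min hex (m := m)
  set k := Nat.find hex
  refine ⟨a + k, by omega, by omega, ?_, ?_⟩
  · rcases Nat.eq_zero_or_pos k with h | h
    · rw [h]; simp only [add_zero]
      have : triM x y a a = 0 := by simp [triM]
      linarith
    · have := hmin (k - 1) (by omega)
      rw [show a + (k - 1) + 1 = a + k by omega] at this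
      linarith
  · have : triM x y a (a + k + 1) + triM x y (a + k + 1) (a + n + 1) = triM x y a (a + n + 1) :=
      Finset.sum_Ico_consecutive _ (by omega) (by omega)
    linarith

theorem triB_bound (hp : 1 < p) (hq : 1 < q) (hs : 1 < 1 / p + 1 / q)
    (hτ : ∀ x y, ‖τ x y‖ ≤ ‖x‖ * ‖y‖) :
    ∃ C : ℝ, 0 ≤ C ∧ ∀ x y a b, ‖triB τ a b x y‖ ≤ C * triM x y a b ^ (1 / p + 1 / q) := by
  set s := 1 / p + 1 / q with hsdef
  have h2 : 2 * (1 / 2 : ℝ) ^ s < 1 := by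
    have : (1 / 2 : ℝ) ^ s < (1 / 2 : ℝ) ^ (1 : ℝ) :=
      Real.rpow_lt_rpow_of_exponent_gt (by norm_num) (by norm_num) hs
    rw [Real.rpow_one] at this; linarith
  have hd : 0 < 1 - 2 * (1 / 2 : ℝ) ^ s := by linarith
  refine ⟨1 / (1 - 2 * (1 / 2 : ℝ) ^ s), by positivity, ?_⟩
  set C := 1 / (1 - 2 * (1 / 2 : ℝ) ^ s) with hC
  have hC0 : 0 ≤ C := by positivity
  have hCe : C * (2 * (1 / 2 : ℝ) ^ s) + 1 = C := by rw [hC]; field_simp; ring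
  intro x y
  have main : ∀ N a b, b ≤ a + N → ‖triB τ a b x y‖ ≤ C * triM x y a b ^ s := by
    intro N
    induction N with
    | zero =>
      intro a b hab
      have : triB τ a b x y = 0 := by
        rw [triB_apply, Finset.Ico_eq_empty (by omega), Finset.sum_empty]
      rw [this, norm_zero]
      have := triM_nonneg x y a b
      positivity
    | succ N ih =>
      intro a b hab
      by_cases hlt : b ≤ a
      · exact ih a b (by omega)
      obtain ⟨n, rfl⟩ : ∃ n, b = a + n + 1 := ⟨b - a - 1, by omega⟩
      obtain ⟨c, hac, hcb, m1, m2⟩ := triM_split x y a n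
      have hM := triM_nonneg x y a (a + n + 1)
      set M := triM x y a (a + n + 1) with hMdef
      have hs0 : 0 ≤ s := by linarith
      have i1 := ih a c (by omega)
      have i2 := ih (c + 1) (a + n + 1) (by omega)
      have j1 : triM x y a c ^ s ≤ M ^ s * (1 / 2) ^ s := by
        rw [← Real.mul_rpow hM (by norm_num)]
        exact Real.rpow_le_rpow (triM_nonneg _ _ _ _) (by linarith) hs0
      have j2 : triM x y (c + 1) (a + n + 1) ^ s ≤ M ^ s * (1 / 2) ^ s := by
        rw [← Real.mul_rpow hM (by norm_num)]
        exact Real.rpow_le_rpow (triM_nonneg _ _ _ _) (by linarith) hs0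
      have j3 : ‖τ (segL _ a (c + 1) x) (segL _ c (a + n + 1) y)‖ ≤ M ^ s := by
        refine (hτ _ _).trans ?_
        rw [hsdef, Real.rpow_add_of_nonneg hM (by positivity) (by positivity)]
        refine mul_le_mul ((triM_x hp x y _ _).trans ?_) ((triM_y hq x y _ _).trans ?_)
          (norm_nonneg _) (by positivity)
        · exact Real.rpow_le_rpow (triM_nonneg _ _ _ _) (triM_mono x y le_rfl (by omega))
            (by positivity)
        · exact Real.rpow_le_rpow (triM_nonneg _ _ _ _) (triM_mono x y hac le_rfl)
            (by positivity)
      rw [triB_split τ hac hcb]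
      have n1 := norm_add₃_le (a := triB τ a c x y)
        (b := τ (segL _ a (c + 1) x) (segL _ c (a + n + 1) y))
        (c := triB τ (c + 1) (a + n + 1) x y)
      have k1 := mul_le_mul_of_nonneg_left j1 hC0
      have k2 := mul_le_mul_of_nonneg_left j2 hC0
      calc _ ≤ C * (M ^ s * (1 / 2) ^ s) + M ^ s + C * (M ^ s * (1 / 2) ^ s) := by linarith
        _ = (C * (2 * (1 / 2 : ℝ) ^ s) + 1) * M ^ s := by ring
        _ = C * M ^ s := by rw [hCe]
  exact fun a b => main b a b (by omega)

theorem triM_le (hp : 1 < p) (hq : 1 < q) (x : Lp' (ENNReal.ofReal p))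
    (y : Lp' (ENNReal.ofReal q)) (a b : ℕ) : triM x y a b ≤ ‖x‖ ^ p + ‖y‖ ^ q := by
  have hp' : (ENNReal.ofReal p).toReal = p := ENNReal.toReal_ofReal (by linarith)
  have hq' : (ENNReal.ofReal q).toReal = q := ENNReal.toReal_ofReal (by linarith)
  have h1 := lp.sum_rpow_le_norm_rpow (by rw [hp']; linarith) x (Finset.Ico a b)
  have h2 := lp.sum_rpow_le_norm_rpow (by rw [hq']; linarith) y (Finset.Ico a b)
  rw [hp'] at h1
  rw [hq'] at h2
  simp only [Real.norm_eq_abs] at h1 h2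
  rw [triM, Finset.sum_add_distrib]
  exact add_le_add h1 h2

theorem triB_bound' (hp : 1 < p) (hq : 1 < q) (hs : 1 < 1 / p + 1 / q)
    (hτ : ∀ x y, ‖τ x y‖ ≤ ‖x‖ * ‖y‖) :
    ∃ C : ℝ, 0 ≤ C ∧ ∀ x y a b, ‖triB τ a b x y‖ ≤ C * (‖x‖ * ‖y‖) := by
  obtain ⟨C, hC, h⟩ := triB_bound τ hp hq hs hτ
  refine ⟨C * 2 ^ (1 / p + 1 / q), by positivity, fun x y a b => ?_⟩
  by_cases hx : x = 0
  · simp [hx]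
  by_cases hy : y = 0
  · simp [hy]
  have hx' := norm_pos_iff.2 hx
  have hy' := norm_pos_iff.2 hy
  have h1 := h (‖x‖⁻¹ • x) (‖y‖⁻¹ • y) a b
  have h2 := triM_le hp hq (‖x‖⁻¹ • x) (‖y‖⁻¹ • y) a b
  have nx : ‖‖x‖⁻¹ • x‖ = 1 := by rw [norm_smul, norm_inv, norm_norm, inv_mul_cancel₀ hx'.ne']
  have ny : ‖‖y‖⁻¹ • y‖ = 1 := by rw [norm_smul, norm_inv, norm_norm, inv_mul_cancel₀ hy'.ne']
  rw [nx, ny, Real.one_rpow, Real.one_rpow] at h2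
  have h3 := Real.rpow_le_rpow (triM_nonneg _ _ _ _) h2 (by linarith : 0 ≤ 1 / p + 1 / q)
  have h4 := h1.trans (mul_le_mul_of_nonneg_left h3 hC)
  rw [map_smul, map_smul, LinearMap.smul_apply, norm_smul, norm_smul, norm_inv, norm_inv,
    norm_norm, norm_norm, show (1 : ℝ) + 1 = 2 by norm_num] at h4
  calc ‖triB τ a b x y‖ = (‖x‖ * ‖y‖) * (‖y‖⁻¹ * (‖x‖⁻¹ * ‖triB τ a b x y‖)) := by
        field_simp
    _ ≤ (‖x‖ * ‖y‖) * _ := mul_le_mul_of_nonneg_left h4 (by positivity)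
    _ = _ := by ring

theorem triB_cauchy (hp : 1 < p) (hq : 1 < q) (hs : 1 < 1 / p + 1 / q)
    (hτ : ∀ x y, ‖τ x y‖ ≤ ‖x‖ * ‖y‖) (x : Lp' (ENNReal.ofReal p))
    (y : Lp' (ENNReal.ofReal q)) : CauchySeq (fun n => triB τ 0 n x y) := by
  obtain ⟨C, hC, h⟩ := triB_bound τ hp hq hs hτ
  have hmono : Monotone (fun n => triM x y 0 n) := fun a b hab => triM_mono x y le_rfl hab
  have hb : BddAbove (Set.range (fun n => triM x y 0 n)) :=
    ⟨‖x‖ ^ p + ‖y‖ ^ q, by rintro _ ⟨n, rfl⟩; exact triM_le hp hq x y 0 n⟩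
  have ht := tendsto_atTop_ciSup hmono hb
  set S := ⨆ n, triM x y 0 n
  have ht0 : Filter.Tendsto (fun n => S - triM x y 0 n) Filter.atTop (nhds 0) := by
    simpa using ht.const_sub S
  have hG : Filter.Tendsto (fun n => ‖x‖ * (S - triM x y 0 n) ^ (1 / q) +
      C * (S - triM x y 0 n) ^ (1 / p + 1 / q)) Filter.atTop (nhds 0) := by
    have t1 := ht0.rpow_const (p := 1 / q) (Or.inr (by positivity))
    have t2 := ht0.rpow_const (p := 1 / p + 1 / q) (Or.inr (by positivity))
    have := (t1.const_mul ‖x‖).add (t2.const_mul C)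
    rwa [Real.zero_rpow (by positivity), Real.zero_rpow (by positivity), mul_zero, mul_zero,
      add_zero] at this
  refine cauchySeq_of_le_tendsto_0' _ ?_ hG
  intro a b hab
  have hm : triM x y a b ≤ S - triM x y 0 a := by
    have e : triM x y 0 a + triM x y a b = triM x y 0 b :=
      Finset.sum_Ico_consecutive _ (by omega) hab
    have : triM x y 0 b ≤ S := le_ciSup hb b
    linarith
  rw [dist_comm, dist_eq_norm, triB_sub τ (Nat.zero_le a) hab, add_assoc, add_sub_cancel_left]
  refine (norm_add_le _ _).trans (add_le_add ((hτ _ _).trans ?_) ((h _ _ _ _).trans ?_))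
  · refine mul_le_mul ?_ ((triM_y hq x y a b).trans ?_) (norm_nonneg _) (norm_nonneg _)
    · have hp' : (ENNReal.ofReal p).toReal = p := ENNReal.toReal_ofReal (by linarith)
      have h1 := lp.sum_rpow_le_norm_rpow (by rw [hp']; linarith) x (Finset.Ico 0 a)
      rw [hp'] at h1
      simp only [Real.norm_eq_abs] at h1
      rw [segL_norm hp]
      have := Real.rpow_le_rpow (Finset.sum_nonneg (by intros; positivity)) h1
        (by positivity : 0 ≤ 1 / p)
      rwa [← Real.rpow_mul (norm_nonneg _), mul_one_div_cancel (by positivity), Real.rpow_one]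
        at this
    · exact Real.rpow_le_rpow (triM_nonneg _ _ _ _) hm (by positivity)
  · exact mul_le_mul_of_nonneg_left
      (Real.rpow_le_rpow (triM_nonneg _ _ _ _) hm (by positivity)) hC

theorem triB_e (i j n : ℕ) (hn : j < n) : triB τ 0 n (e' _ i) (e' _ j) =
    if i ≤ j then τ (e' _ i) (e' _ j) else 0 := by
  rw [triB_apply]
  have : ∀ k ∈ Finset.Ico 0 n, τ (segL _ 0 (k + 1) (e' _ i)) (segL _ k (k + 1) (e' _ j)) =
      if k = j then (if i ≤ j then τ (e' _ i) (e' _ j) else 0) else 0 := by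
    intro k _
    rw [segL_e, segL_e]
    by_cases hk : k = j
    · subst hk
      by_cases hi : i ≤ k
      · simp [hi, Nat.lt_succ_iff]
      · simp [hi, Nat.lt_succ_iff]
    · rw [if_neg hk, if_neg (show ¬ (k ≤ j ∧ j < k + 1) by omega), map_zero]
  rw [Finset.sum_congr rfl this, Finset.sum_ite_eq']
  simp [hn]

theorem trunc_exists [CompleteSpace Z] (hp : 1 < p) (hq : 1 < q) (hs : 1 < 1 / p + 1 / q)
    (hτ : ∀ x y, ‖τ x y‖ ≤ ‖x‖ * ‖y‖) :
    ∃ (V : Lp' (ENNReal.ofReal p) →ₗ[ℝ] Lp' (ENNReal.ofReal q) →ₗ[ℝ] Z) (C : ℝ), 0 ≤ C ∧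
      (∀ x y, ‖V x y‖ ≤ C * (‖x‖ * ‖y‖)) ∧
      ∀ i j, V (e' _ i) (e' _ j) = if i ≤ j then τ (e' _ i) (e' _ j) else 0 := by
  have hlim := fun x y => cauchySeq_tendsto_of_complete (triB_cauchy τ hp hq hs hτ x y)
  choose v hv using hlim
  obtain ⟨C, hC, hb⟩ := triB_bound' τ hp hq hs hτ
  refine ⟨LinearMap.mk₂ ℝ v ?_ ?_ ?_ ?_, C, hC, ?_, ?_⟩
  · intro x x' y
    refine tendsto_nhds_unique (hv _ _) ?_
    simpa using (hv x y).add (hv x' y)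
  · intro c x y
    refine tendsto_nhds_unique (hv _ _) ?_
    simpa using (hv x y).const_smul c
  · intro x y y'
    refine tendsto_nhds_unique (hv _ _) ?_
    simpa using (hv x y).add (hv x y')
  · intro c x y
    refine tendsto_nhds_unique (hv _ _) ?_
    simpa using (hv x y).const_smul c
  · intro x y
    exact le_of_tendsto (hv x y).norm (Filter.Eventually.of_forall fun n => hb x y 0 n)
  · intro i j
    refine tendsto_nhds_unique (hv _ _) ?_
    refine tendsto_const_nhds.congr' ?_
    filter_upwards [Filter.eventually_gt_atTop j] with n hn
    exact (triB_e τ i j n hn).symm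

end trunc

/-- recursively defined matrices with small norm and large triangular part. -/
def triMat : ℕ → ℕ → ℕ → ℝ
  | 0, _, _ => 0
  | k + 1, i, j => (if i < 2 ^ k then 1 else -1) / (2 * 2 ^ k) +
      (if i < 2 ^ k then (if j < 2 ^ k then triMat k i j else 0)
        else (if j < 2 ^ k then 0 else triMat k (i - 2 ^ k) (j - 2 ^ k)))

theorem tri_clarkson {r : ℝ} (h1 : 1 < r) (h2 : r ≤ 2) (a m : ℝ) :
    |a + m| ^ r + |a - m| ^ r ≤ 2 * |a| ^ r + 2 * |m| ^ r := by
  have key : ∀ t : ℝ, |t| ^ r = (t ^ 2) ^ (r / 2) := by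
    intro t
    rw [← sq_abs, ← Real.rpow_natCast, ← Real.rpow_mul (abs_nonneg t)]
    congr 1; push_cast; ring
  have hcc : ConcaveOn ℝ (Set.Ici 0) fun x : ℝ => x ^ (r / 2) :=
    Real.concaveOn_rpow (by linarith) (by linarith)
  have hc := hcc.2 (Set.mem_Ici.2 (sq_nonneg (a + m)))
    (Set.mem_Ici.2 (sq_nonneg (a - m)))
    (show (0 : ℝ) ≤ 1 / 2 by norm_num) (show (0 : ℝ) ≤ 1 / 2 by norm_num) (by norm_num)
  simp only [smul_eq_mul] at hc
  have e : (1 / 2 * (a + m) ^ 2 + 1 / 2 * (a - m) ^ 2 : ℝ) = a ^ 2 + m ^ 2 := by ring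
  rw [e] at hc
  have hs := Real.rpow_add_le_add_rpow (p := r / 2) (sq_nonneg a) (sq_nonneg m) (by linarith)
    (by linarith)
  rw [key, key, key, key]
  linarith

theorem triMat_row_left (k i : ℕ) (hi : i < 2 ^ k) (f : ℕ → ℝ) :
    ∑ j ∈ Finset.range (2 ^ (k + 1)), triMat (k + 1) i j * f j =
      (∑ j ∈ Finset.range (2 ^ (k + 1)), f j) / (2 * 2 ^ k) +
      ∑ j ∈ Finset.range (2 ^ k), triMat k i j * f j := by
  have e : ∀ j, triMat (k + 1) i j * f j =
      f j / (2 * 2 ^ k) + (if j < 2 ^ k then triMat k i j else 0) * f j := by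
    intro j; simp only [triMat, hi, if_true]; ring
  simp only [e, Finset.sum_add_distrib, Finset.sum_div]
  congr 1
  rw [pow_succ, mul_two, Finset.sum_range_add]
  have : ∑ x ∈ Finset.range (2 ^ k),
    (if 2 ^ k + x < 2 ^ k then triMat k i (2 ^ k + x) else 0) * f (2 ^ k + x) = 0 := by
    apply Finset.sum_eq_zero; intro x _; simp
  rw [this, add_zero]
  apply Finset.sum_congr rfl; intro x hx; rw [if_pos (Finset.mem_range.1 hx)]

theorem triMat_row_right (k i : ℕ) (f : ℕ → ℝ) :
    ∑ j ∈ Finset.range (2 ^ (k + 1)), triMat (k + 1) (2 ^ k + i) j * f j =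
      -((∑ j ∈ Finset.range (2 ^ (k + 1)), f j) / (2 * 2 ^ k)) +
      ∑ j ∈ Finset.range (2 ^ k), triMat k i j * f (2 ^ k + j) := by
  have hi : ¬ (2 ^ k + i < 2 ^ k) := by omega
  have e : ∀ j, triMat (k + 1) (2 ^ k + i) j * f j =
      -(f j / (2 * 2 ^ k)) + (if j < 2 ^ k then 0 else triMat k i (j - 2 ^ k)) * f j := by
    intro j; simp only [triMat, hi, if_false, Nat.add_sub_cancel_left]; ring
  simp only [e, Finset.sum_add_distrib, Finset.sum_div, Finset.sum_neg_distrib]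
  congr 1
  rw [pow_succ, mul_two, Finset.sum_range_add]
  have : ∑ x ∈ Finset.range (2 ^ k),
    (if x < 2 ^ k then 0 else triMat k i (x - 2 ^ k)) * f x = 0 := by
    apply Finset.sum_eq_zero; intro x hx; simp [Finset.mem_range.1 hx]
  rw [this, zero_add]
  apply Finset.sum_congr rfl; intro x hx; simp

theorem tri_jensen {r : ℝ} (h1 : 1 ≤ r) (n : ℕ) (hn : 0 < n) (f : ℕ → ℝ) :
    n * |(∑ j ∈ Finset.range n, f j) / n| ^ r ≤ ∑ j ∈ Finset.range n, |f j| ^ r := by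
  have hn' : (0 : ℝ) < n := by exact_mod_cast hn
  have := Real.rpow_arith_mean_le_arith_mean_rpow (Finset.range n) (fun _ => (1 / n : ℝ))
    (fun j => |f j|) (by intros; positivity) (by simp; field_simp) (by intros; positivity) h1
  rw [← Finset.mul_sum, ← Finset.mul_sum] at this
  have h2 : |(∑ j ∈ Finset.range n, f j) / n| ^ r ≤
      (1 / n * ∑ j ∈ Finset.range n, |f j|) ^ r := by
    apply Real.rpow_le_rpow (abs_nonneg _) _ (by linarith)
    rw [abs_div, abs_of_pos hn', div_eq_inv_mul, one_div]
    gcongr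
    exact Finset.abs_sum_le_sum_abs _ _
  calc _ ≤ (n : ℝ) * (1 / n * ∑ j ∈ Finset.range n, |f j| ^ r) := by gcongr; linarith
    _ = _ := by field_simp

theorem triMat_bound {r : ℝ} (h1 : 1 < r) (h2 : r ≤ 2) (k : ℕ) : ∀ (a : ℝ) (f : ℕ → ℝ),
    ∑ i ∈ Finset.range (2 ^ k), |a + ∑ j ∈ Finset.range (2 ^ k), triMat k i j * f j| ^ r ≤
      2 ^ k * |a| ^ r + k * ∑ j ∈ Finset.range (2 ^ k), |f j| ^ r := by
  induction k with
  | zero => intro a f; simp [triMat]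
  | succ k ih =>
    intro a f
    set m := (∑ j ∈ Finset.range (2 ^ (k + 1)), f j) / (2 * 2 ^ k) with hm
    have hJ := tri_jensen h1.le (2 ^ (k + 1)) (by positivity) f
    have e0 : (((2 ^ (k + 1) : ℕ)) : ℝ) = 2 * 2 ^ k := by push_cast; ring
    rw [e0, ← hm] at hJ
    have hl : ∑ i ∈ Finset.range (2 ^ k),
        |a + ∑ j ∈ Finset.range (2 ^ (k + 1)), triMat (k + 1) i j * f j| ^ r =
        ∑ i ∈ Finset.range (2 ^ k),
        |(a + m) + ∑ j ∈ Finset.range (2 ^ k), triMat k i j * f j| ^ r := by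
      apply Finset.sum_congr rfl; intro i hi
      rw [triMat_row_left k i (Finset.mem_range.1 hi), add_assoc]
    have hr : ∑ i ∈ Finset.range (2 ^ k),
        |a + ∑ j ∈ Finset.range (2 ^ (k + 1)), triMat (k + 1) (2 ^ k + i) j * f j| ^ r =
        ∑ i ∈ Finset.range (2 ^ k),
        |(a - m) + ∑ j ∈ Finset.range (2 ^ k), triMat k i j * f (2 ^ k + j)| ^ r := by
      apply Finset.sum_congr rfl; intro i hi
      rw [triMat_row_right k i, ← add_assoc, ← sub_eq_add_neg]
    have i1 := ih (a + m) f
    have i2 := ih (a - m) (fun j => f (2 ^ k + j))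
    have hc := tri_clarkson h1 h2 a m
    have hsplit : ∀ g : ℕ → ℝ, ∑ j ∈ Finset.range (2 ^ (k + 1)), g j =
        ∑ j ∈ Finset.range (2 ^ k), g j + ∑ j ∈ Finset.range (2 ^ k), g (2 ^ k + j) := by
      intro g; rw [pow_succ, mul_two, Finset.sum_range_add]
    rw [hsplit (fun i => |a + ∑ j ∈ Finset.range (2 ^ (k + 1)), triMat (k + 1) i j * f j| ^ r),
      hl, hr]
    have hs2 := hsplit (fun j => |f j| ^ r)
    have hc2 := mul_le_mul_of_nonneg_left hc (show (0 : ℝ) ≤ 2 ^ k by positivity)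
    have : ((k + 1 : ℕ) : ℝ) * ∑ j ∈ Finset.range (2 ^ (k + 1)), |f j| ^ r =
      k * (∑ j ∈ Finset.range (2 ^ k), |f j| ^ r) +
      k * (∑ j ∈ Finset.range (2 ^ k), |f (2 ^ k + j)| ^ r) +
      ∑ j ∈ Finset.range (2 ^ (k + 1)), |f j| ^ r := by
      push_cast; rw [hs2]; ring
    rw [this, pow_succ]
    nlinarith

theorem tri_sign_sum (n : ℕ) : ∑ i ∈ Finset.range n, ∑ j ∈ Finset.range (n + n),
    (if i ≤ j then (1 : ℝ) else 0) - ∑ i ∈ Finset.range n, ∑ j ∈ Finset.range (n + n),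
    (if n + i ≤ j then (1 : ℝ) else 0) = n * n := by
  have e1 : ∀ i ∈ Finset.range n, ∑ j ∈ Finset.range (n + n), (if i ≤ j then (1 : ℝ) else 0) =
      n + ∑ j ∈ Finset.range (n + n), (if n + i ≤ j then (1 : ℝ) else 0) := by
    intro i hi
    have hi := Finset.mem_range.1 hi
    rw [Finset.sum_range_add, Finset.sum_range_add]
    have a1 : ∑ x ∈ Finset.range n, (if n + i ≤ x then (1 : ℝ) else 0) = 0 := by
      apply Finset.sum_eq_zero; intro x hx; have := Finset.mem_range.1 hx; rw [if_neg]; omega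
    have a2 : ∑ x ∈ Finset.range n, (if i ≤ n + x then (1 : ℝ) else 0) = n := by
      rw [Finset.sum_congr rfl (g := fun _ => (1 : ℝ))]
      · simp
      · intro x hx; rw [if_pos]; omega
    rw [a1, a2]; simp; ring
  rw [Finset.sum_congr rfl e1, Finset.sum_add_distrib]
  simp

theorem triMat_sum (k : ℕ) : ∑ i ∈ Finset.range (2 ^ k), ∑ j ∈ Finset.range (2 ^ k),
    (if i ≤ j then triMat k i j else 0) = k * 2 ^ k / 4 := by
  induction k with
  | zero => simp [triMat]
  | succ k ih =>
    have hl : ∀ i ∈ Finset.range (2 ^ k), ∑ j ∈ Finset.range (2 ^ (k + 1)),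
        (if i ≤ j then triMat (k + 1) i j else 0) =
        (∑ j ∈ Finset.range (2 ^ (k + 1)), (if i ≤ j then (1 : ℝ) else 0)) / (2 * 2 ^ k) +
        ∑ j ∈ Finset.range (2 ^ k), (if i ≤ j then triMat k i j else 0) := by
      intro i hi
      have := triMat_row_left k i (Finset.mem_range.1 hi) (fun j => if i ≤ j then 1 else 0)
      simpa using this
    have hr : ∀ i ∈ Finset.range (2 ^ k), ∑ j ∈ Finset.range (2 ^ (k + 1)),
        (if 2 ^ k + i ≤ j then triMat (k + 1) (2 ^ k + i) j else 0) =
        -((∑ j ∈ Finset.range (2 ^ (k + 1)), (if 2 ^ k + i ≤ j then (1 : ℝ) else 0))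
          / (2 * 2 ^ k)) +
        ∑ j ∈ Finset.range (2 ^ k), (if i ≤ j then triMat k i j else 0) := by
      intro i hi
      have := triMat_row_right k i (fun j => if 2 ^ k + i ≤ j then 1 else 0)
      simpa using this
    have hs := tri_sign_sum (2 ^ k)
    have hsplit : ∀ g : ℕ → ℝ, ∑ j ∈ Finset.range (2 ^ (k + 1)), g j =
        ∑ j ∈ Finset.range (2 ^ k), g j + ∑ j ∈ Finset.range (2 ^ k), g (2 ^ k + j) := by
      intro g; rw [pow_succ, mul_two, Finset.sum_range_add]
    rw [hsplit, Finset.sum_congr rfl hl, Finset.sum_congr rfl hr, Finset.sum_add_distrib,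
      Finset.sum_add_distrib, ih, Finset.sum_neg_distrib, ← Finset.sum_div, ← Finset.sum_div]
    rw [← mul_two, ← pow_succ] at hs
    have : ∀ A B : ℝ, A - B = 2 ^ k * 2 ^ k → A / (2 * 2 ^ k) + k * 2 ^ k / 4 +
      (-(B / (2 * 2 ^ k)) + k * 2 ^ k / 4) = ((k + 1 : ℕ) : ℝ) * 2 ^ (k + 1) / 4 := by
      intro A B h
      have hA : A = B + 2 ^ k * 2 ^ k := by linarith
      subst hA
      push_cast; field_simp; ring
    apply this
    push_cast at hs
    exact hs

theorem tri_holder {r p : ℝ} (h1 : 1 < r) (h2 : r ≤ p) (n : ℕ) (hn : 0 < n) (f : ℕ → ℝ) :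
    (∑ i ∈ Finset.range n, |f i| ^ r) ^ (1 / r) ≤
      (n : ℝ) ^ (1 / r - 1 / p) * (∑ i ∈ Finset.range n, |f i| ^ p) ^ (1 / p) := by
  have hn' : (0 : ℝ) < n := by exact_mod_cast hn
  have hr : 0 < r := by linarith
  have hp : 0 < p := by linarith
  have hJ := tri_jensen (r := p / r) (by rw [le_div_iff₀ hr]; linarith) n hn
    (fun i => |f i| ^ r)
  have e : ∀ i, |(|f i| ^ r)| ^ (p / r) = |f i| ^ p := by
    intro i
    rw [abs_of_nonneg (by positivity), ← Real.rpow_mul (abs_nonneg _)]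
    congr 1; field_simp
  simp only [e] at hJ
  set S := ∑ i ∈ Finset.range n, |f i| ^ r with hS
  have hS0 : 0 ≤ S := Finset.sum_nonneg (by intros; positivity)
  rw [abs_of_nonneg (by positivity)] at hJ
  have h3 := Real.rpow_le_rpow (by positivity) hJ (show 0 ≤ 1 / p by positivity)
  rw [Real.mul_rpow hn'.le (by positivity), ← Real.rpow_mul (by positivity),
    show p / r * (1 / p) = 1 / r by field_simp, Real.div_rpow hS0 hn'.le] at h3
  calc S ^ (1 / r) = (n : ℝ) ^ (1 / r - 1 / p) *
        ((n : ℝ) ^ (1 / p) * (S ^ (1 / r) / (n : ℝ) ^ (1 / r))) := by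
        rw [Real.rpow_sub hn']
        have := (Real.rpow_pos_of_pos hn' (1 / p)).ne'
        have := (Real.rpow_pos_of_pos hn' (1 / r)).ne'
        field_simp
    _ ≤ _ := by gcongr

theorem triMat_form {r p q : ℝ} (h1 : 1 < r) (h2 : r ≤ 2) (hq : r ≤ q) (hp : r / (r - 1) ≤ p)
    (k : ℕ) (f g : ℕ → ℝ) :
    |∑ i ∈ Finset.range (2 ^ k), ∑ j ∈ Finset.range (2 ^ k), triMat k i j * f i * g j| ≤
      ((k : ℝ) ^ (1 / r) * (2 ^ k : ℝ) ^ (1 - 1 / p - 1 / q)) *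
      ((∑ i ∈ Finset.range (2 ^ k), |f i| ^ p) ^ (1 / p) *
        (∑ j ∈ Finset.range (2 ^ k), |g j| ^ q) ^ (1 / q)) := by
  have hr : 0 < r := by linarith
  have hc : r.HolderConjugate (r / (r - 1)) := Real.HolderConjugate.conjExponent h1
  have h1' : 1 < r / (r - 1) := by rw [lt_div_iff₀ (by linarith)]; linarith
  have hb := triMat_bound h1 h2 k 0 g
  rw [abs_zero, Real.zero_rpow hr.ne', mul_zero, zero_add] at hb
  simp only [zero_add] at hb
  have hH := Real.inner_le_Lp_mul_Lq (Finset.range (2 ^ k))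
    (fun i => |∑ j ∈ Finset.range (2 ^ k), triMat k i j * g j|) (fun i => |f i|) hc
  simp only [abs_abs] at hH
  have hb2 := Real.rpow_le_rpow (Finset.sum_nonneg (by intros; positivity)) hb
    (show 0 ≤ 1 / r by positivity)
  rw [Real.mul_rpow (by positivity) (Finset.sum_nonneg (by intros; positivity))] at hb2
  have g1 := tri_holder h1 hq (2 ^ k) (by positivity) g
  have g2 := tri_holder h1' hp (2 ^ k) (by positivity) f
  push_cast at g1 g2
  have e2 : (2 ^ k : ℝ) ^ (1 - 1 / p - 1 / q) =
      (2 ^ k : ℝ) ^ (1 / r - 1 / q) * (2 ^ k : ℝ) ^ (1 / (r / (r - 1)) - 1 / p) := by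
    rw [← Real.rpow_add (by positivity)]
    congr 1
    have : 1 / (r / (r - 1)) = 1 - 1 / r := by
      have : r - 1 ≠ 0 := by linarith
      field_simp
    rw [this]; ring
  calc _ ≤ ∑ i ∈ Finset.range (2 ^ k),
        |∑ j ∈ Finset.range (2 ^ k), triMat k i j * g j| * |f i| := by
        refine (Finset.abs_sum_le_sum_abs _ _).trans (le_of_eq ?_)
        apply Finset.sum_congr rfl; intro i _
        rw [← abs_mul, Finset.sum_mul]
        congr 1; apply Finset.sum_congr rfl; intros; ring
    _ ≤ _ := hH
    _ ≤ (k ^ (1 / r) * ((2 ^ k : ℝ) ^ (1 / r - 1 / q) *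
          (∑ j ∈ Finset.range (2 ^ k), |g j| ^ q) ^ (1 / q))) *
        ((2 ^ k : ℝ) ^ (1 / (r / (r - 1)) - 1 / p) *
          (∑ i ∈ Finset.range (2 ^ k), |f i| ^ p) ^ (1 / p)) := by
        refine mul_le_mul (hb2.trans ?_) g2 (by positivity) (by positivity)
        gcongr
    _ = _ := by rw [e2]; ring

theorem triMat_exists {p q : ℝ} (hp : 1 < p) (hq : 1 < q) (hpq : 1 / p + 1 / q ≤ 1) :
    ∃ θ : ℝ, θ < 1 ∧ ∀ k : ℕ, ∃ b : ℕ → ℕ → ℝ,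
      (∀ f g : ℕ → ℝ,
        |∑ i ∈ Finset.range (2 ^ k), ∑ j ∈ Finset.range (2 ^ k), b i j * f i * g j| ≤
        ((k : ℝ) ^ θ * (2 ^ k : ℝ) ^ (1 - 1 / p - 1 / q)) *
        ((∑ i ∈ Finset.range (2 ^ k), |f i| ^ p) ^ (1 / p) *
          (∑ j ∈ Finset.range (2 ^ k), |g j| ^ q) ^ (1 / q))) ∧
      ∑ i ∈ Finset.range (2 ^ k), ∑ j ∈ Finset.range (2 ^ k),
        (if i ≤ j then b i j else 0) = k * 2 ^ k / 4 := by
  have hp0 : 0 < p := by linarith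
  have hq0 : 0 < q := by linarith
  have hconj : ∀ x y : ℝ, 1 < x → 0 < y → 1 / x + 1 / y ≤ 1 → x / (x - 1) ≤ y := by
    intro x y hx hy h
    rw [div_le_iff₀ (by linarith)]
    have hx0 : 0 < x := by linarith
    have : 1 / x + 1 / y = (x + y) / (x * y) := by field_simp; ring
    rw [this, div_le_one (by positivity)] at h
    nlinarith
  have hr1 : ∀ r : ℝ, 1 < r → 1 / r < 1 := by
    intro r hr; rw [div_lt_one (by linarith)]; exact hr
  by_cases h2 : q ≤ 2
  · refine ⟨1 / q, hr1 q hq, fun k => ⟨triMat k, fun f g => ?_, triMat_sum k⟩⟩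
    exact triMat_form hq h2 le_rfl (hconj q p hq hp0 (by linarith)) k f g
  by_cases h3 : 2 ≤ p
  · refine ⟨1 / 2, by norm_num, fun k => ⟨triMat k, fun f g => ?_, triMat_sum k⟩⟩
    exact triMat_form (by norm_num) le_rfl (by linarith) (by norm_num; exact h3) k f g
  push Not at h2 h3
  refine ⟨1 / p, hr1 p hp, fun k =>
    ⟨fun i j => triMat k (2 ^ k - 1 - j) (2 ^ k - 1 - i), fun f g => ?_, ?_⟩⟩
  · have := triMat_form (r := p) (p := q) (q := p) hp h3.le le_rfl (hconj p q hp hq0 hpq) k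
      (fun i => g (2 ^ k - 1 - i)) (fun i => f (2 ^ k - 1 - i))
    rw [Finset.sum_range_reflect (fun i => |g i| ^ q),
      Finset.sum_range_reflect (fun i => |f i| ^ p)] at this
    convert this using 1
    · congr 1
      rw [Finset.sum_comm, ← Finset.sum_range_reflect]
      apply Finset.sum_congr rfl; intro i hi
      rw [← Finset.sum_range_reflect]
      apply Finset.sum_congr rfl; intro j hj
      have := Finset.mem_range.1 hi
      have := Finset.mem_range.1 hj
      beta_reduce
      rw [show 2 ^ k - 1 - (2 ^ k - 1 - i) = i by omega,
        show 2 ^ k - 1 - (2 ^ k - 1 - j) = j by omega]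
      ring
    · rw [show 1 - 1 / q - 1 / p = 1 - 1 / p - 1 / q by ring]; ring
  · rw [← triMat_sum, Finset.sum_comm, ← Finset.sum_range_reflect]
    apply Finset.sum_congr rfl; intro i hi
    rw [← Finset.sum_range_reflect]
    apply Finset.sum_congr rfl; intro j hj
    have := Finset.mem_range.1 hi
    have := Finset.mem_range.1 hj
    simp only []
    rw [show 2 ^ k - 1 - (2 ^ k - 1 - i) = i by omega,
      show 2 ^ k - 1 - (2 ^ k - 1 - j) = j by omega]
    have : 2 ^ k - 1 - j ≤ 2 ^ k - 1 - i ↔ i ≤ j := by omega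
    simp only [this]


theorem sumE_norm {p : ℝ} [Fact (1 ≤ ENNReal.ofReal p)] (hp : 1 < p) (n : ℕ) :
    ‖∑ i ∈ Finset.range n, e' (ENNReal.ofReal p) i‖ = (n : ℝ) ^ (1 / p) := by
  have hp0 : 0 < p := by linarith
  have hr : (ENNReal.ofReal p).toReal = p := ENNReal.toReal_ofReal hp0.le
  have := lp.norm_sum_single (p := ENNReal.ofReal p) (E := fun _ : ℕ => ℝ) (by rw [hr]; exact hp0)
    (fun _ => (1 : ℝ)) (Finset.range n)
  rw [hr] at this
  simp only [norm_one, Real.one_rpow, Finset.sum_const, Finset.card_range, nsmul_eq_mul,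
    mul_one] at this
  change ‖∑ i ∈ Finset.range n, lp.single (ENNReal.ofReal p) i (1 : ℝ)‖ = _
  rw [← this, ← Real.rpow_mul (norm_nonneg _), mul_one_div_cancel hp0.ne', Real.rpow_one]

theorem range_norm_le {p : ℝ} [Fact (1 ≤ ENNReal.ofReal p)] (hp : 1 < p) (n : ℕ)
    (x : Lp' (ENNReal.ofReal p)) :
    (∑ i ∈ Finset.range n, |x i| ^ p) ^ (1 / p) ≤ ‖x‖ := by
  have hp' : (ENNReal.ofReal p).toReal = p := ENNReal.toReal_ofReal (by linarith)
  have h1 := lp.sum_rpow_le_norm_rpow (by rw [hp']; linarith) x (Finset.range n)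
  rw [hp'] at h1
  simp only [Real.norm_eq_abs] at h1
  have := Real.rpow_le_rpow (Finset.sum_nonneg (by intros; positivity)) h1
    (by positivity : 0 ≤ 1 / p)
  rwa [← Real.rpow_mul (norm_nonneg _), mul_one_div_cancel (by positivity), Real.rpow_one]
    at this

/-- the bilinear form given by a finite matrix. -/
def matForm (P Q : ℝ≥0∞) [Fact (1 ≤ P)] [Fact (1 ≤ Q)] (b : ℕ → ℕ → ℝ) (n : ℕ) :
    Lp' P →ₗ[ℝ] Lp' Q →ₗ[ℝ] ℝ :=
  LinearMap.mk₂ ℝ (fun x y => ∑ i ∈ Finset.range n, ∑ j ∈ Finset.range n, b i j * x i * y j)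
    (by
      intro x x' y
      simp only [lp.coeFn_add, Pi.add_apply, ← Finset.sum_add_distrib]
      refine Finset.sum_congr rfl fun i _ => Finset.sum_congr rfl fun j _ => ?_
      ring)
    (by
      intro c x y
      simp only [lp.coeFn_smul, Pi.smul_apply, smul_eq_mul, Finset.mul_sum]
      refine Finset.sum_congr rfl fun i _ => Finset.sum_congr rfl fun j _ => ?_
      ring)
    (by
      intro x y y'
      simp only [lp.coeFn_add, Pi.add_apply, ← Finset.sum_add_distrib]
      refine Finset.sum_congr rfl fun i _ => Finset.sum_congr rfl fun j _ => ?_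
      ring)
    (by
      intro c x y
      simp only [lp.coeFn_smul, Pi.smul_apply, smul_eq_mul, Finset.mul_sum]
      refine Finset.sum_congr rfl fun i _ => Finset.sum_congr rfl fun j _ => ?_
      ring)

theorem matForm_apply (P Q : ℝ≥0∞) [Fact (1 ≤ P)] [Fact (1 ≤ Q)] (b : ℕ → ℕ → ℝ) (n : ℕ)
    (x : Lp' P) (y : Lp' Q) : matForm P Q b n x y =
      ∑ i ∈ Finset.range n, ∑ j ∈ Finset.range n, b i j * x i * y j := rfl

theorem matForm_e (P Q : ℝ≥0∞) [Fact (1 ≤ P)] [Fact (1 ≤ Q)] (b : ℕ → ℕ → ℝ) (n : ℕ)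
    {i j : ℕ} (hi : i < n) (hj : j < n) : matForm P Q b n (e' P i) (e' Q j) = b i j := by
  rw [matForm_apply, Finset.sum_eq_single i, Finset.sum_eq_single j]
  · simp [e']
  · intro l _ hl
    simp [e', Pi.single_eq_of_ne hl]
  · intro h; exact absurd (Finset.mem_range.2 hj) h
  · intro l _ hl
    simp [e', Pi.single_eq_of_ne hl]
  · intro h; exact absurd (Finset.mem_range.2 hi) h

theorem not_bounded (p : Fin 2 → ℝ) [∀ i, Fact (1 ≤ ENNReal.ofReal (p i))] (hp : ∀ i, 1 < p i)
    (T : LpT p →L[ℝ] LpT p)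
    (hT : ∀ i j : ℕ, T (eT p ![i, j]) = if i ≤ j then eT p ![i, j] else 0)
    (hle : 1 / p 0 + 1 / p 1 ≤ 1) : False := by
  obtain ⟨θ, hθ, hb⟩ := triMat_exists (hp 0) (hp 1) hle
  have key : ∀ k : ℕ, 1 ≤ k → (k : ℝ) ^ (1 - θ) ≤ 4 * ‖T‖ := by
    intro k hk
    obtain ⟨b, h1, h2⟩ := hb k
    have hk0 : (0 : ℝ) < k := by exact_mod_cast hk
    have hC : 0 ≤ (k : ℝ) ^ θ * (2 ^ k : ℝ) ^ (1 - 1 / p 0 - 1 / p 1) := by positivity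
    obtain ⟨L, hL, hLn⟩ := tpL_lift p (matForm _ _ b (2 ^ k)) _ hC (by
      intro x y
      rw [matForm_apply, Real.norm_eq_abs]
      refine (h1 _ _).trans (mul_le_mul_of_nonneg_left ?_ hC)
      exact mul_le_mul (range_norm_le (hp 0) _ x) (range_norm_le (hp 1) _ y)
        (Real.rpow_nonneg (Finset.sum_nonneg (by intros; positivity)) _) (norm_nonneg _))
    set z := tpL p (∑ i ∈ Finset.range (2 ^ k), e' _ i) (∑ j ∈ Finset.range (2 ^ k), e' _ j)
      with hz
    have hzn : ‖z‖ ≤ (2 ^ k : ℝ) ^ (1 / p 0) * (2 ^ k : ℝ) ^ (1 / p 1) := by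
      refine (tpL_norm_le p _ _).trans (le_of_eq ?_)
      rw [sumE_norm (hp 0), sumE_norm (hp 1)]
      push_cast; rfl
    have hzs : z = ∑ i ∈ Finset.range (2 ^ k), ∑ j ∈ Finset.range (2 ^ k),
        eT p ![i, j] := by
      rw [hz, map_sum, Finset.sum_comm]
      refine Finset.sum_congr rfl fun j _ => ?_
      rw [map_sum, LinearMap.sum_apply]
      exact Finset.sum_congr rfl fun i _ => (eT_eq p i j).symm
    have hLT : L (T z) = k * 2 ^ k / 4 := by
      rw [hzs, ← h2, map_sum, map_sum]
      refine Finset.sum_congr rfl fun i hi => ?_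
      rw [map_sum, map_sum]
      refine Finset.sum_congr rfl fun j hj => ?_
      rw [hT]
      split_ifs
      · rw [eT_eq, hL, matForm_e _ _ _ _ (Finset.mem_range.1 hi) (Finset.mem_range.1 hj)]
      · exact map_zero L
    have h3 := hLn (T z)
    rw [hLT, Real.norm_eq_abs, abs_of_nonneg (by positivity)] at h3
    have h4 : ‖T z‖ ≤ ‖T‖ * ((2 ^ k : ℝ) ^ (1 / p 0) * (2 ^ k : ℝ) ^ (1 / p 1)) :=
      (T.le_opNorm z).trans (mul_le_mul_of_nonneg_left hzn (norm_nonneg _))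
    have h5 := h3.trans (mul_le_mul_of_nonneg_left h4 hC)
    have h2k : (0 : ℝ) < 2 ^ k := by positivity
    have e1 : (2 ^ k : ℝ) ^ (1 - 1 / p 0 - 1 / p 1) * ((2 ^ k : ℝ) ^ (1 / p 0) *
        (2 ^ k : ℝ) ^ (1 / p 1)) = 2 ^ k := by
      rw [← Real.rpow_add h2k, ← Real.rpow_add h2k]
      rw [show 1 - 1 / p 0 - 1 / p 1 + (1 / p 0 + 1 / p 1) = 1 by ring, Real.rpow_one]
    have h6 : (k : ℝ) * 2 ^ k / 4 ≤ (k : ℝ) ^ θ * ‖T‖ * 2 ^ k := by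
      refine h5.trans (le_of_eq ?_)
      calc _ = (k : ℝ) ^ θ * ‖T‖ * ((2 ^ k : ℝ) ^ (1 - 1 / p 0 - 1 / p 1) *
            ((2 ^ k : ℝ) ^ (1 / p 0) * (2 ^ k : ℝ) ^ (1 / p 1))) := by ring
        _ = _ := by rw [e1]
    have h7 : (k : ℝ) ≤ 4 * ‖T‖ * (k : ℝ) ^ θ := by
      refine le_of_mul_le_mul_right ?_ h2k
      linarith
    rw [Real.rpow_sub hk0, Real.rpow_one, div_le_iff₀ (Real.rpow_pos_of_pos hk0 θ)]
    exact h7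
  have ht : Filter.Tendsto (fun k : ℕ => (k : ℝ) ^ (1 - θ)) Filter.atTop Filter.atTop :=
    (tendsto_rpow_atTop (by linarith : 0 < 1 - θ)).comp tendsto_natCast_atTop_atTop
  obtain ⟨k, hk1, hk2⟩ := ((ht.eventually_gt_atTop (4 * ‖T‖)).and
    (Filter.eventually_ge_atTop 1)).exists
  exact absurd (key k hk2) (not_le.2 hk1)

/-- For `1 < p, q < ∞`, the main triangular projection
`e_i ⊗ e_j ↦ (if i ≤ j then e_i ⊗ e_j else 0)` extends to a bounded operator on
`ℓ_p ⊗̂ ℓ_q` if and only if `1/p + 1/q > 1`. -/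
theorem stmt3 (p : Fin 2 → ℝ) [∀ i, Fact (1 ≤ ENNReal.ofReal (p i))] (hp : ∀ i, 1 < p i) :
    (∃ T : LpT p →L[ℝ] LpT p,
        ∀ i j : ℕ, T (eT p ![i, j]) = if i ≤ j then eT p ![i, j] else 0) ↔
      1 / p 0 + 1 / p 1 > 1 := by
  constructor
  · rintro ⟨T, hT⟩
    by_contra h
    exact not_bounded p hp T hT (not_lt.1 h)
  · intro h
    obtain ⟨V, C, hC, hV, he⟩ := trunc_exists (tpL p) (hp 0) (hp 1) h (tpL_norm_le p)
    obtain ⟨L, hL, _⟩ := tpL_lift p V C hC hV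
    exact ⟨L, fun i j => by rw [eT_eq, hL, he]⟩
end
end

section
/- Let 1 < p ≤ q < ∞. Then ℓ_p ⊗̂ ℓ_{q'} is isomorphic to the ℓ₁-sum (Σ ⊕ ℓ_p ⊗̂ ℓ_{q'})₁ of countably many copies of itself, where 1/q + 1/q' = 1; consequently B(ℓ_p, ℓ_q) ≅ (ℓ_p ⊗̂ ℓ_{q'})* is isomorphic to the ℓ∞-sum (Σ ⊕ B(ℓ_p, ℓ_q))_∞ of countably many copies of itself. -/
open scoped TensorProduct ENNReal
open PiTensorProduct

noncomputable section

variable (ι : Type*) [Fintype ι] (E : ι → Type*)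
  [∀ i, NormedAddCommGroup (E i)] [∀ i, NormedSpace ℝ (E i)]

instance : Fact ((1 : ℝ≥0∞) ≤ ∞) := ⟨le_top⟩

instance {a b : ℝ} [Fact (1 ≤ ENNReal.ofReal a)] [Fact (1 ≤ ENNReal.ofReal b)] :
    ∀ i : Fin 2, Fact (1 ≤ ENNReal.ofReal (![a, b] i)) := fun i =>
  i.cases (inferInstanceAs (Fact (1 ≤ ENNReal.ofReal a)))
    (fun j => j.cases (inferInstanceAs (Fact (1 ≤ ENNReal.ofReal b))) (fun k => k.elim0))


section ProjAPI

variable {κ : Type} [Fintype κ] {V : κ → Type} [∀ i, NormedAddCommGroup (V i)]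
  [∀ i, NormedSpace ℝ (V i)] {F : Type} [NormedAddCommGroup F] [NormedSpace ℝ F]

theorem norm_tprodC_le (m : Π i, V i) : ‖tprodC m‖ ≤ ∏ i, ‖m i‖ := by
  unfold tprodC
  exact (le_of_eq (UniformSpace.Completion.norm_coe _)).trans (projectiveSeminorm_tprod_le m)

/-- The canonical multilinear map. -/
def tprodM (V : κ → Type) [∀ i, NormedAddCommGroup (V i)]
    [∀ i, NormedSpace ℝ (V i)] : ContinuousMultilinearMap ℝ V (ProjTensor κ V) :=
  MultilinearMap.mkContinuous
    ((UniformSpace.Completion.toComplL (𝕜 := ℝ) (E := ⨂[ℝ] i, V i)).toLinearMap.compMultilinearMap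
      (tprod ℝ)) 1 (fun m => by
        rw [one_mul]; exact norm_tprodC_le m)

theorem tprodM_apply (m : Π i, V i) : tprodM V m = tprodC m := rfl

/-- The algebraic lift as a continuous map. -/
def liftAlg (f : ContinuousMultilinearMap ℝ V F) : (⨂[ℝ] i, V i) →L[ℝ] F :=
  LinearMap.mkContinuous (lift f.toMultilinearMap) ‖f‖ fun x =>
    norm_eval_le_projectiveSeminorm f x

/-- The lift to the completed projective tensor product. -/
def liftC [CompleteSpace F] (f : ContinuousMultilinearMap ℝ V F) : ProjTensor κ V →L[ℝ] F :=
  (liftAlg f).extend (UniformSpace.Completion.toComplL (𝕜 := ℝ) (E := ⨂[ℝ] i, V i))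

theorem liftC_coe [CompleteSpace F] (f : ContinuousMultilinearMap ℝ V F) (x : ⨂[ℝ] i, V i) :
    liftC f (x : ProjTensor κ V) = lift f.toMultilinearMap x := 
  ContinuousLinearMap.extend_eq (e := UniformSpace.Completion.toComplL (𝕜 := ℝ) (E := ⨂[ℝ] i, V i)) (liftAlg f)
    (UniformSpace.Completion.denseRange_coe)
    (UniformSpace.Completion.isUniformInducing_coe _) x

theorem liftC_tprodC [CompleteSpace F] (f : ContinuousMultilinearMap ℝ V F) (m : Π i, V i) :
    liftC f (tprodC m) = f m := by
  unfold tprodC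
  rw [liftC_coe, lift.tprod]; rfl

theorem norm_liftC_le [CompleteSpace F] (f : ContinuousMultilinearMap ℝ V F) :
    ‖liftC f‖ ≤ ‖f‖ := by
  refine ContinuousLinearMap.opNorm_le_bound _ (norm_nonneg _) fun x => ?_
  induction x using UniformSpace.Completion.induction_on with
  | hp => exact isClosed_le (by fun_prop) (by fun_prop)
  | ih x =>
    rw [liftC_coe, UniformSpace.Completion.norm_coe]
    exact norm_eval_le_projectiveSeminorm f x

theorem proj_ext {f g : ProjTensor κ V →L[ℝ] F} (h : ∀ m, f (tprodC m) = g (tprodC m)) : f = g := by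
  ext x
  induction x using UniformSpace.Completion.induction_on with
  | hp => exact isClosed_eq (by fun_prop) (by fun_prop)
  | ih x =>
    have : f.toLinearMap.comp (UniformSpace.Completion.toComplL (𝕜 := ℝ) (E := ⨂[ℝ] i, V i)).toLinearMap
        = g.toLinearMap.comp (UniformSpace.Completion.toComplL (𝕜 := ℝ) (E := ⨂[ℝ] i, V i)).toLinearMap := by
      apply PiTensorProduct.ext
      ext m
      exact h m
    exact LinearMap.congr_fun this x

/-- Functoriality. -/
def mapC (f : Π i, V i →L[ℝ] V i) : ProjTensor κ V →L[ℝ] ProjTensor κ V :=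
  liftC ((tprodM V).compContinuousLinearMap f)

theorem mapC_tprodC (f : Π i, V i →L[ℝ] V i) (m : Π i, V i) :
    mapC f (tprodC m) = tprodC (fun i => f i (m i)) := by
  unfold mapC
  rw [liftC_tprodC]; rfl

theorem norm_mapC_le (f : Π i, V i →L[ℝ] V i) (hf : ∀ i, ‖f i‖ ≤ 1) : ‖mapC f‖ ≤ 1 := by
  refine (norm_liftC_le _).trans ?_
  refine ContinuousMultilinearMap.opNorm_le_bound zero_le_one fun m => ?_
  rw [one_mul]
  refine (norm_tprodC_le _).trans ?_
  refine Finset.prod_le_prod (fun _ _ => norm_nonneg _) fun i _ => ?_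
  simpa using (f i).le_of_opNorm_le (hf i) (m i)

end ProjAPI

section LpTools

variable {X : Type} [NormedAddCommGroup X] [NormedSpace ℝ X] {r : ℝ≥0∞} [Fact (1 ≤ r)]

theorem toReal_pos_of {r : ℝ≥0∞} [h : Fact (1 ≤ r)] (hr : r ≠ ∞) : 0 < r.toReal :=
  ENNReal.toReal_pos (zero_lt_one.trans_le h.out).ne' hr

/-- Restriction along an injection. -/
def restr (hr : r ≠ ∞) (σ : ℕ → ℕ) (hσ : Function.Injective σ) :
    lp (fun _ : ℕ => X) r →L[ℝ] lp (fun _ : ℕ => X) r :=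
  LinearMap.mkContinuous
    { toFun := fun x => ⟨fun n => x (σ n), memℓp_gen
        (((lp.memℓp x).summable (toReal_pos_of hr)).comp_injective hσ)⟩
      map_add' := fun x y => rfl
      map_smul' := fun x y => by ext; simp } 1 (fun x => by
        rw [one_mul]
        refine lp.norm_le_of_tsum_le (toReal_pos_of hr) (norm_nonneg _) ?_
        rw [lp.norm_rpow_eq_tsum (toReal_pos_of hr) x]
        have hs := (lp.memℓp x).summable (toReal_pos_of hr)
        exact tsum_comp_le_tsum_of_inj hs (fun _ => by positivity) hσ)

@[simp]
theorem restr_apply (hr : r ≠ ∞) (σ : ℕ → ℕ) (hσ : Function.Injective σ)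
    (x : lp (fun _ : ℕ => X) r) (n : ℕ) : restr hr σ hσ x n = x (σ n) := rfl

theorem extend_aux (hr : r ≠ ∞) (σ : ℕ → ℕ) (hσ : Function.Injective σ)
    (x : lp (fun _ : ℕ => X) r) :
    HasSum (fun n => ‖Function.extend σ (fun k => x k) 0 n‖ ^ r.toReal) (‖x‖ ^ r.toReal) := by
  have h := lp.hasSum_norm (toReal_pos_of hr) x
  rw [← hσ.hasSum_iff]
  · convert h using 2 with n
    simp [hσ.extend_apply]
  · intro n hn
    rw [Function.extend_apply' _ _ _ (by simpa using hn)]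
    simp [Real.zero_rpow (toReal_pos_of hr).ne']

/-- Extension by zero along an injection. -/
def extn (hr : r ≠ ∞) (σ : ℕ → ℕ) (hσ : Function.Injective σ) :
    lp (fun _ : ℕ => X) r →L[ℝ] lp (fun _ : ℕ => X) r :=
  LinearMap.mkContinuous
    { toFun := fun x => ⟨Function.extend σ (fun k => x k) 0, memℓp_gen
        (extend_aux hr σ hσ x).summable⟩
      map_add' := fun x y => by
        ext n
        change Function.extend σ (fun k => x k + y k) 0 n =
          Function.extend σ (fun k => x k) 0 n + Function.extend σ (fun k => y k) 0 n
        by_cases h : ∃ k, σ k = n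
        · obtain ⟨k, rfl⟩ := h
          simp [hσ.extend_apply]
        · simp [Function.extend_apply' _ _ _ h]
      map_smul' := fun c y => by
        ext n
        by_cases h : ∃ k, σ k = n
        · obtain ⟨k, rfl⟩ := h
          simp [hσ.extend_apply]
        · simp [Function.extend_apply' _ _ _ h] } 1 (fun x => by
        rw [one_mul]
        refine lp.norm_le_of_tsum_le (toReal_pos_of hr) (norm_nonneg _) ?_
        exact (extend_aux hr σ hσ x).tsum_eq.le)

@[simp]
theorem extn_apply (hr : r ≠ ∞) (σ : ℕ → ℕ) (hσ : Function.Injective σ)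
    (x : lp (fun _ : ℕ => X) r) (n : ℕ) : extn hr σ hσ x (σ n) = x n :=
  hσ.extend_apply _ _ _

theorem extn_apply_ne (hr : r ≠ ∞) (σ : ℕ → ℕ) (hσ : Function.Injective σ)
    (x : lp (fun _ : ℕ => X) r) (n : ℕ) (h : ∀ k, σ k ≠ n) : extn hr σ hσ x n = 0 :=
  Function.extend_apply' _ _ _ (by simpa using h)

theorem norm_restr_le (hr : r ≠ ∞) (σ : ℕ → ℕ) (hσ : Function.Injective σ) :
    ‖(restr hr σ hσ : lp (fun _ : ℕ => X) r →L[ℝ] _)‖ ≤ 1 :=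
  LinearMap.mkContinuous_norm_le _ zero_le_one _

theorem norm_extn_le (hr : r ≠ ∞) (σ : ℕ → ℕ) (hσ : Function.Injective σ) :
    ‖(extn hr σ hσ : lp (fun _ : ℕ => X) r →L[ℝ] _)‖ ≤ 1 :=
  LinearMap.mkContinuous_norm_le _ zero_le_one _

theorem inj_even : Function.Injective (fun n : ℕ => 2 * n) := fun a b h => by simpa using h
theorem inj_odd : Function.Injective (fun n : ℕ => 2 * n + 1) := fun a b h => by simpa using h

/-- `A ≅ A × A`. -/
def evenOdd (hr : r ≠ ∞) : lp (fun _ : ℕ => X) r ≃L[ℝ]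
    lp (fun _ : ℕ => X) r × lp (fun _ : ℕ => X) r :=
  ContinuousLinearEquiv.equivOfInverse
    ((restr hr _ inj_even).prod (restr hr _ inj_odd))
    ((extn hr _ inj_even).comp (ContinuousLinearMap.fst ℝ _ _) +
      (extn hr _ inj_odd).comp (ContinuousLinearMap.snd ℝ _ _))
    (fun x => by
      ext n
      rcases Nat.even_or_odd' n with ⟨k, rfl | rfl⟩
      · have h1 := extn_apply hr _ inj_even (restr hr _ inj_even x) k
        have h2 := extn_apply_ne hr _ inj_odd (restr hr _ inj_odd x) (2 * k) (by grind)
        simp only at h1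
        simp [h1, h2]
      · have h1 := extn_apply hr _ inj_odd (restr hr _ inj_odd x) k
        have h2 := extn_apply_ne hr _ inj_even (restr hr _ inj_even x) (2 * k + 1) (by grind)
        simp only at h1
        simp [h1, h2])
    (fun ⟨x, y⟩ => by
      ext n
      · have h1 := extn_apply hr _ inj_even x n
        have h2 := extn_apply_ne hr _ inj_odd y (2 * n) (by grind)
        simp only at h1
        simp [h1, h2]
      · have h1 := extn_apply hr _ inj_odd y n
        have h2 := extn_apply_ne hr _ inj_even x (2 * n + 1) (by grind)
        simp only at h1
        simp [h1, h2])

/-- `A ≅ A × X`. -/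
def succZero (hr : r ≠ ∞) : lp (fun _ : ℕ => X) r ≃L[ℝ] lp (fun _ : ℕ => X) r × X :=
  ContinuousLinearEquiv.equivOfInverse
    ((restr hr _ Nat.succ_injective).prod (lp.evalCLM ℝ (fun _ : ℕ => X) r 0))
    ((extn hr _ Nat.succ_injective).comp (ContinuousLinearMap.fst ℝ _ _) +
      (lp.singleContinuousLinearMap ℝ (fun _ : ℕ => X) r 0).comp (ContinuousLinearMap.snd ℝ _ _))
    (fun x => by
      ext n
      rcases n with _ | k
      · have h2 := extn_apply_ne hr _ Nat.succ_injective (restr hr _ Nat.succ_injective x) 0 (by grind)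
        simp [h2, lp.evalCLM]
      · have h1 := extn_apply hr _ Nat.succ_injective (restr hr _ Nat.succ_injective x) k
        simp only [Nat.succ_eq_add_one] at h1
        simp [h1])
    (fun ⟨x, y⟩ => by
      ext n
      · have h1 := extn_apply hr _ Nat.succ_injective x n
        simp only [Nat.succ_eq_add_one] at h1
        simp [h1]
      · have h2 := extn_apply_ne hr _ Nat.succ_injective x 0 (by grind)
        simp [h2, lp.evalCLM])

/-- Pełczyński decomposition. -/
theorem pelczynski (hr : r ≠ ∞) (f : lp (fun _ : ℕ => X) r →L[ℝ] X)
    (g : X →L[ℝ] lp (fun _ : ℕ => X) r) (h : ∀ u, g (f u) = u) :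
    Nonempty (X ≃L[ℝ] lp (fun _ : ℕ => X) r) := by
  let e := ContinuousLinearEquiv.equivOfRightInverse g f h
  exact ⟨e.trans <| ((evenOdd hr).prodCongr (.refl ℝ _)).trans <|
    (ContinuousLinearEquiv.prodAssoc ℝ _ _ _).trans <|
    ((ContinuousLinearEquiv.refl ℝ _).prodCongr e.symm).trans (succZero hr).symm⟩

end LpTools

section Block

theorem inj_pair (n : ℕ) : Function.Injective (fun k => Nat.pair n k) := fun a b h => by
  simpa using h

/-- Block restriction. -/
def Rb (ρ : ℝ) [Fact (1 ≤ ENNReal.ofReal ρ)] (n : ℕ) :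
    Lp' (ENNReal.ofReal ρ) →L[ℝ] Lp' (ENNReal.ofReal ρ) :=
  restr ENNReal.ofReal_ne_top _ (inj_pair n)

/-- Block inclusion. -/
def Jb (ρ : ℝ) [Fact (1 ≤ ENNReal.ofReal ρ)] (n : ℕ) :
    Lp' (ENNReal.ofReal ρ) →L[ℝ] Lp' (ENNReal.ofReal ρ) :=
  extn ENNReal.ofReal_ne_top _ (inj_pair n)

theorem Rb_Jb_self (ρ : ℝ) [Fact (1 ≤ ENNReal.ofReal ρ)] (n : ℕ) (x : Lp' (ENNReal.ofReal ρ)) :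
    Rb ρ n (Jb ρ n x) = x := by
  ext k
  exact extn_apply ENNReal.ofReal_ne_top _ (inj_pair n) x k

theorem Rb_Jb_ne (ρ : ℝ) [Fact (1 ≤ ENNReal.ofReal ρ)] (n m : ℕ) (h : n ≠ m)
    (x : Lp' (ENNReal.ofReal ρ)) :
    Rb ρ n (Jb ρ m x) = 0 := by
  ext k
  refine extn_apply_ne ENNReal.ofReal_ne_top _ (inj_pair m) x (Nat.pair n k) fun j hj => ?_
  simp at hj
  exact h hj.1.symm

theorem rho_ge (ρ : ℝ) [h : Fact (1 ≤ ENNReal.ofReal ρ)] : 1 ≤ ρ := by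
  simpa using h.out

theorem toReal_rho (ρ : ℝ) [Fact (1 ≤ ENNReal.ofReal ρ)] : (ENNReal.ofReal ρ).toReal = ρ :=
  ENNReal.toReal_ofReal (zero_le_one.trans (rho_ge ρ))

theorem sum_Rb_le (ρ : ℝ) [Fact (1 ≤ ENNReal.ofReal ρ)] (x : Lp' (ENNReal.ofReal ρ))
    (s : Finset ℕ) : ∑ n ∈ s, ‖Rb ρ n x‖ ^ ρ ≤ ‖x‖ ^ ρ := by
  have h0 : 0 < (ENNReal.ofReal ρ).toReal := toReal_pos_of ENNReal.ofReal_ne_top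
  have hx := lp.hasSum_norm h0 x
  have h2 : HasSum (fun z : ℕ × ℕ => ‖x (Nat.pair z.1 z.2)‖ ^ (ENNReal.ofReal ρ).toReal)
      (‖x‖ ^ (ENNReal.ofReal ρ).toReal) := (Nat.pairEquiv.hasSum_iff
        (f := fun n => ‖x n‖ ^ (ENNReal.ofReal ρ).toReal)).2 hx
  have h3 := h2.prod_fiberwise (fun n => lp.hasSum_norm h0 (Rb ρ n x))
  have h4 := sum_le_hasSum s (fun n _ => by positivity) h3
  rwa [toReal_rho] at h4

theorem holder_block {p q q' : ℝ} (hpq : p ≤ q) (hp : 0 < p) (hc : q.HolderConjugate q')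
    (a b : ℕ → ℝ) (ha : ∀ n, 0 ≤ a n) (hb : ∀ n, 0 ≤ b n) (A B : ℝ) (hA : 0 ≤ A) (hB : 0 ≤ B)
    (s : Finset ℕ) (hsa : ∑ n ∈ s, a n ^ p ≤ A ^ p) (hsb : ∑ n ∈ s, b n ^ q' ≤ B ^ q') :
    ∑ n ∈ s, a n * b n ≤ A * B := by
  have hq : 0 < q := hc.pos
  have hq' : 0 < q' := hc.symm.pos
  have haA : ∀ n ∈ s, a n ≤ A := fun n hn => by
    have : a n ^ p ≤ A ^ p :=
      (Finset.single_le_sum (f := fun n => a n ^ p) (fun i _ => Real.rpow_nonneg (ha i) p) hn).trans hsa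
    exact (Real.rpow_le_rpow_iff (ha n) hA hp).1 this
  have hsq : ∑ n ∈ s, a n ^ q ≤ A ^ q := by
    calc ∑ n ∈ s, a n ^ q ≤ ∑ n ∈ s, a n ^ p * A ^ (q - p) := by
          refine Finset.sum_le_sum fun n hn => ?_
          have : a n ^ q = a n ^ p * a n ^ (q - p) := by
            rw [← Real.rpow_add_of_nonneg (ha n) hp.le (by linarith)]; ring_nf
          rw [this]
          exact mul_le_mul_of_nonneg_left
            (Real.rpow_le_rpow (ha n) (haA n hn) (by linarith)) (Real.rpow_nonneg (ha n) p)
      _ = (∑ n ∈ s, a n ^ p) * A ^ (q - p) := by rw [Finset.sum_mul]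
      _ ≤ A ^ p * A ^ (q - p) := by gcongr
      _ = A ^ q := by
          rw [← Real.rpow_add_of_nonneg hA hp.le (by linarith)]; ring_nf
  have h := Real.inner_le_Lp_mul_Lq_of_nonneg s hc (fun i _ => ha i) (fun i _ => hb i)
  refine h.trans ?_
  have e1 : (∑ n ∈ s, a n ^ q) ^ (1 / q) ≤ A := by
    rw [one_div]
    exact (Real.rpow_inv_le_iff_of_pos (Finset.sum_nonneg fun i _ => Real.rpow_nonneg (ha i) q) hA hq).2 hsq
  have e2 : (∑ n ∈ s, b n ^ q') ^ (1 / q') ≤ B := by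
    rw [one_div]
    exact (Real.rpow_inv_le_iff_of_pos (Finset.sum_nonneg fun i _ => Real.rpow_nonneg (hb i) q') hB hq').2 hsb
  exact mul_le_mul e1 e2 (Real.rpow_nonneg (Finset.sum_nonneg fun i _ => Real.rpow_nonneg (hb i) q') _) hA

variable (r : Fin 2 → ℝ) [∀ i, Fact (1 ≤ ENNReal.ofReal (r i))]

theorem sum_block_le {q : ℝ} (hpq : r 0 ≤ q) (hc : q.HolderConjugate (r 1))
    (m : Π i, Lp' (ENNReal.ofReal (r i))) (s : Finset ℕ) :
    ∑ n ∈ s, ‖tprodC (fun i => Rb (r i) n (m i))‖ ≤ ∏ i, ‖m i‖ := by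
  rw [Fin.prod_univ_two]
  refine (Finset.sum_le_sum fun n _ => norm_tprodC_le _).trans ?_
  simp only [Fin.prod_univ_two]
  exact holder_block hpq (zero_lt_one.trans_le (rho_ge (r 0))) hc (fun n => ‖Rb (r 0) n (m 0)‖)
    (fun n => ‖Rb (r 1) n (m 1)‖) (fun _ => norm_nonneg _) (fun _ => norm_nonneg _) _ _
    (norm_nonneg _) (norm_nonneg _) s (sum_Rb_le _ _ s) (sum_Rb_le _ _ s)

/-- The multilinear map `m ↦ (R_n m)_n` into the `ℓ₁`-sum. -/
def gM {q : ℝ} (hpq : r 0 ≤ q) (hc : q.HolderConjugate (r 1)) :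
    ContinuousMultilinearMap ℝ (fun i => Lp' (ENNReal.ofReal (r i)))
      (lp (fun _ : ℕ => LpT r) 1) :=
  MultilinearMap.mkContinuous
    { toFun := fun m => ⟨fun n =>
        ((tprodM (fun i => Lp' (ENNReal.ofReal (r i)))).compContinuousLinearMap
          (fun i => Rb (r i) n)) m, memℓp_gen' (C := ∏ i, ‖m i‖) (fun s => by
            simp only [ENNReal.toReal_one, Real.rpow_one]
            exact sum_block_le r hpq hc m s)⟩
      map_update_add' := fun m i x y => by
        ext n
        exact ContinuousMultilinearMap.map_update_add _ m i x y
      map_update_smul' := fun m i c x => by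
        ext n
        exact ContinuousMultilinearMap.map_update_smul _ m i c x } 1 (fun m => by
        rw [one_mul]
        refine lp.norm_le_of_forall_sum_le (by simp) (by positivity) fun s => ?_
        simp only [ENNReal.toReal_one, Real.rpow_one]
        exact sum_block_le r hpq hc m s)

theorem gM_apply {q : ℝ} (hpq : r 0 ≤ q) (hc : q.HolderConjugate (r 1))
    (m : Π i, Lp' (ENNReal.ofReal (r i))) (n : ℕ) :
    gM r hpq hc m n = tprodC (fun i => Rb (r i) n (m i)) := rfl

/-- Sum of blocks. -/
def fC : lp (fun _ : ℕ => LpT r) 1 →L[ℝ] LpT r :=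
  (lp.tsumCLM ℝ ℕ (LpT r)).comp
    (lp.mapCLM 1 (fun n => mapC (fun i => Jb (r i) n)) zero_le_one
      (fun n => norm_mapC_le _ fun i => norm_extn_le _ _ _))

theorem fC_single (n : ℕ) (u : LpT r) :
    fC r (lp.single 1 n u) = mapC (fun i => Jb (r i) n) u := by
  change ∑' k, mapC (fun i => Jb (r i) k) ((lp.single 1 n u : lp (fun _ : ℕ => LpT r) 1) k) = _
  rw [tsum_eq_single n]
  · simp
  · intro k hk
    rw [lp.single_apply_ne _ _ _ hk, map_zero]

theorem iso1 {q : ℝ} (hpq : r 0 ≤ q) (hc : q.HolderConjugate (r 1)) :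
    Nonempty (LpT r ≃L[ℝ] lp (fun _ : ℕ => LpT r) 1) := by
  refine pelczynski ENNReal.one_ne_top (fC r) (liftC (gM r hpq hc)) ?_
  suffices h : (liftC (gM r hpq hc)).comp (fC r) = ContinuousLinearMap.id ℝ _ by
    exact fun u => DFunLike.congr_fun h u
  refine lp.ext_continuousLinearMap ENNReal.one_ne_top fun n => ?_
  refine proj_ext fun m => ?_
  change liftC (gM r hpq hc) (fC r (lp.single 1 n (tprodC m))) = lp.single 1 n (tprodC m)
  rw [fC_single, mapC_tprodC, liftC_tprodC]
  ext k
  rw [gM_apply]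
  by_cases h : k = n
  · subst h
    rw [lp.single_apply_self]
    congr 1
    ext1 i
    exact Rb_Jb_self _ _ _
  · rw [lp.single_apply_ne _ _ _ h, ← tprodM_apply]
    refine ContinuousMultilinearMap.map_coord_zero _ 0 ?_
    exact Rb_Jb_ne _ _ _ h _

end Block

section Duals

variable {V : Fin 2 → Type} [∀ i, NormedAddCommGroup (V i)] [∀ i, NormedSpace ℝ (V i)]

/-- The pair `(x, y)` as a dependent function. -/
def pr2 (x : V 0) (y : V 1) : Π i, V i := Function.update (Function.update 0 0 x) 1 y

theorem pr2_zero (x : V 0) (y : V 1) : pr2 x y 0 = x := by simp [pr2]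
theorem pr2_one (x : V 0) (y : V 1) : pr2 x y 1 = y := by simp [pr2]
theorem pr2_comm (x : V 0) (y : V 1) :
    pr2 x y = Function.update (Function.update (0 : Π i, V i) 1 y) 0 x :=
  Function.update_comm (show (0 : Fin 2) ≠ 1 by decide) x y (0 : Π i, V i)
theorem pr2_eta (m : Π i, V i) : pr2 (m 0) (m 1) = m := by
  funext i
  match i with
  | 0 => exact pr2_zero _ _
  | 1 => exact pr2_one _ _

/-- The canonical bilinear map. -/
def bil (V : Fin 2 → Type) [∀ i, NormedAddCommGroup (V i)] [∀ i, NormedSpace ℝ (V i)] :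
    V 0 →L[ℝ] V 1 →L[ℝ] ProjTensor (Fin 2) V :=
  LinearMap.mkContinuous₂ (LinearMap.mk₂ ℝ (fun x y => tprodM V (pr2 x y))
    (fun x x' y => by simp only [pr2_comm, ContinuousMultilinearMap.map_update_add])
    (fun c x y => by simp only [pr2_comm, ContinuousMultilinearMap.map_update_smul])
    (fun x y y' => by simp only [pr2, ContinuousMultilinearMap.map_update_add])
    (fun c x y => by simp only [pr2, ContinuousMultilinearMap.map_update_smul])) 1
    (fun x y => by
      have := norm_tprodC_le (pr2 x y)
      rw [Fin.prod_univ_two, pr2_zero, pr2_one] at this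
      rw [one_mul]
      exact this)

theorem bil_apply (x : V 0) (y : V 1) : bil V x y = tprodC (pr2 x y) := rfl

theorem norm_bil_le : ‖bil V‖ ≤ 1 := LinearMap.mkContinuous₂_norm_le _ zero_le_one _

/-- A bilinear form as a multilinear form. -/
def bM (β : V 0 →L[ℝ] V 1 →L[ℝ] ℝ) : ContinuousMultilinearMap ℝ V ℝ :=
  MultilinearMap.mkContinuous
    { toFun := fun m => β (m 0) (m 1)
      map_update_add' := fun m i x y => by
        match i with
        | 0 => simp
        | 1 => simp
      map_update_smul' := fun m i c x => by
        match i with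
        | 0 => simp
        | 1 => simp } ‖β‖ (fun m => by
        rw [Fin.prod_univ_two, ← mul_assoc]
        exact β.le_opNorm₂ _ _)

theorem bM_apply (β : V 0 →L[ℝ] V 1 →L[ℝ] ℝ) (m : Π i, V i) : bM β m = β (m 0) (m 1) := rfl

theorem norm_bM_le (β : V 0 →L[ℝ] V 1 →L[ℝ] ℝ) : ‖bM β‖ ≤ ‖β‖ :=
  ContinuousMultilinearMap.opNorm_le_bound (norm_nonneg β) fun m => by
    rw [Fin.prod_univ_two, ← mul_assoc]
    exact β.le_opNorm₂ _ _

theorem norm_bil_apply_le (x : V 0) (y : V 1) : ‖bil V x y‖ ≤ ‖x‖ * ‖y‖ := by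
  have := norm_tprodC_le (pr2 x y)
  rw [Fin.prod_univ_two, pr2_zero, pr2_one] at this
  exact this

/-- Restriction of a functional to elementary tensors. -/
def dualFwd (φ : ProjTensor (Fin 2) V →L[ℝ] ℝ) : V 0 →L[ℝ] V 1 →L[ℝ] ℝ :=
  LinearMap.mkContinuous₂ (LinearMap.mk₂ ℝ (fun x y => φ (bil V x y))
    (fun x x' y => by rw [map_add, ContinuousLinearMap.add_apply, map_add])
    (fun c x y => by rw [map_smul, ContinuousLinearMap.smul_apply, map_smul])
    (fun x y y' => by rw [map_add, map_add])
    (fun c x y => by rw [map_smul, map_smul])) ‖φ‖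
    (fun x y => by
      rw [mul_assoc]
      exact φ.le_opNorm_of_le (norm_bil_apply_le x y))

theorem dualFwd_apply (φ : ProjTensor (Fin 2) V →L[ℝ] ℝ) (x : V 0) (y : V 1) :
    dualFwd φ x y = φ (bil V x y) := rfl

theorem norm_dualFwd_le (φ : ProjTensor (Fin 2) V →L[ℝ] ℝ) : ‖dualFwd φ‖ ≤ ‖φ‖ :=
  LinearMap.mkContinuous₂_norm_le _ (norm_nonneg _) _

/-- `(V₀ ⊗̂ V₁)* ≅ B(V₀, V₁*)`, algebraically. -/
def dualLin (V : Fin 2 → Type) [∀ i, NormedAddCommGroup (V i)] [∀ i, NormedSpace ℝ (V i)] :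
    (ProjTensor (Fin 2) V →L[ℝ] ℝ) ≃ₗ[ℝ] (V 0 →L[ℝ] V 1 →L[ℝ] ℝ) where
  toFun := dualFwd
  map_add' := fun φ ψ => by ext x y; rfl
  map_smul' := fun c ψ => by ext x y; rfl
  invFun := fun β => liftC (bM β)
  left_inv := fun φ => by
    refine proj_ext fun m => ?_
    rw [liftC_tprodC, bM_apply, dualFwd_apply, bil_apply, pr2_eta]
  right_inv := fun β => by
    ext x y
    rw [dualFwd_apply, bil_apply, liftC_tprodC, bM_apply, pr2_zero, pr2_one]

theorem norm_dualLin_le (V : Fin 2 → Type) [∀ i, NormedAddCommGroup (V i)]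
    [∀ i, NormedSpace ℝ (V i)] (φ : ProjTensor (Fin 2) V →L[ℝ] ℝ) :
    ‖dualLin V φ‖ ≤ 1 * ‖φ‖ := by
  rw [one_mul]
  exact norm_dualFwd_le φ

theorem norm_dualLin_symm_le (V : Fin 2 → Type) [∀ i, NormedAddCommGroup (V i)]
    [∀ i, NormedSpace ℝ (V i)] (β : V 0 →L[ℝ] V 1 →L[ℝ] ℝ) :
    ‖(dualLin V).symm β‖ ≤ 1 * ‖β‖ := by
  have h : (dualLin V).symm β = liftC (bM β) := rfl
  have h2 := norm_liftC_le (bM β)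
  have h3 := norm_bM_le β
  rw [one_mul, h]
  exact h2.trans h3

/-- `(V₀ ⊗̂ V₁)* ≅ B(V₀, V₁*)`. -/
def dualIso (V : Fin 2 → Type) [∀ i, NormedAddCommGroup (V i)] [∀ i, NormedSpace ℝ (V i)] :
    (ProjTensor (Fin 2) V →L[ℝ] ℝ) ≃L[ℝ] (V 0 →L[ℝ] V 1 →L[ℝ] ℝ) :=
  { dualLin V with
    continuous_toFun := AddMonoidHomClass.continuous_of_bound (dualLin V) 1 (norm_dualLin_le V)
    continuous_invFun :=
      AddMonoidHomClass.continuous_of_bound (dualLin V).symm 1 (norm_dualLin_symm_le V) }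

end Duals

section L1dual

variable {X : Type} [NormedAddCommGroup X] [NormedSpace ℝ X]

/-- The pairing map `ℓ∞(X*) → (ℓ₁(X))*`. -/
def l1fwd (X : Type) [NormedAddCommGroup X] [NormedSpace ℝ X] :
    lp (fun _ : ℕ => X →L[ℝ] ℝ) ∞ →L[ℝ] (lp (fun _ : ℕ => X) 1 →L[ℝ] ℝ) :=
  lp.dualPairing ∞ 1 (fun _ : ℕ => ContinuousLinearMap.id ℝ (X →L[ℝ] ℝ)) (K := 1)
          (fun _ => ContinuousLinearMap.norm_id_le)

theorem l1fwd_apply (φ : lp (fun _ : ℕ => X →L[ℝ] ℝ) ∞) (x : lp (fun _ : ℕ => X) 1) :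
    l1fwd X φ x = ∑' k, φ k (x k) := rfl

/-- Coordinate functionals. -/
def l1coord (φ : lp (fun _ : ℕ => X) 1 →L[ℝ] ℝ) (n : ℕ) : X →L[ℝ] ℝ :=
  φ.comp (lp.singleContinuousLinearMap ℝ (fun _ : ℕ => X) 1 n)

theorem l1coord_apply (φ : lp (fun _ : ℕ => X) 1 →L[ℝ] ℝ) (n : ℕ) (x : X) :
    l1coord φ n x = φ (lp.single 1 n x) := rfl

theorem norm_l1coord_le (φ : lp (fun _ : ℕ => X) 1 →L[ℝ] ℝ) (n : ℕ) : ‖l1coord φ n‖ ≤ ‖φ‖ := by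
  refine ContinuousLinearMap.opNorm_le_bound _ (norm_nonneg _) fun x => ?_
  rw [l1coord_apply]
  refine φ.le_opNorm_of_le ?_
  simp

/-- The inverse map. -/
def l1inv (φ : lp (fun _ : ℕ => X) 1 →L[ℝ] ℝ) : lp (fun _ : ℕ => X →L[ℝ] ℝ) ∞ :=
  ⟨l1coord φ, memℓp_infty ⟨‖φ‖, by
          rintro _ ⟨n, rfl⟩
          exact norm_l1coord_le φ n⟩⟩

theorem l1inv_apply (φ : lp (fun _ : ℕ => X) 1 →L[ℝ] ℝ) (n : ℕ) : l1inv φ n = l1coord φ n := rfl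

theorem norm_l1inv_le (φ : lp (fun _ : ℕ => X) 1 →L[ℝ] ℝ) : ‖l1inv φ‖ ≤ ‖φ‖ :=
  lp.norm_le_of_forall_le (norm_nonneg _) fun n => norm_l1coord_le φ n

theorem l1_left_inv (φ : lp (fun _ : ℕ => X →L[ℝ] ℝ) ∞) : l1inv (l1fwd X φ) = φ := by
  refine lp.ext (funext fun n => ?_)
  refine ContinuousLinearMap.ext fun x => ?_
  rw [l1inv_apply, l1coord_apply, l1fwd_apply, tsum_eq_single n]
  · rw [lp.single_apply_self]
  · intro k hk
    rw [lp.single_apply_ne _ _ _ hk, map_zero]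

theorem l1_right_inv (φ : lp (fun _ : ℕ => X) 1 →L[ℝ] ℝ) : l1fwd X (l1inv φ) = φ := by
  refine lp.ext_continuousLinearMap ENNReal.one_ne_top fun n => ?_
  refine ContinuousLinearMap.ext fun x => ?_
  change l1fwd X (l1inv φ) (lp.single 1 n x) = φ (lp.single 1 n x)
  rw [l1fwd_apply, tsum_eq_single n]
  · rw [lp.single_apply_self, l1inv_apply, l1coord_apply]
  · intro k hk
    rw [lp.single_apply_ne _ _ _ hk, map_zero]

/-- Algebraic version. -/
def l1lin (X : Type) [NormedAddCommGroup X] [NormedSpace ℝ X] :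
    lp (fun _ : ℕ => X →L[ℝ] ℝ) ∞ ≃ₗ[ℝ] (lp (fun _ : ℕ => X) 1 →L[ℝ] ℝ) where
  toFun := l1fwd X
  map_add' := map_add (l1fwd X)
  map_smul' := map_smul (l1fwd X)
  invFun := l1inv
  left_inv := l1_left_inv
  right_inv := l1_right_inv

/-- `(ℓ₁(X))* ≅ ℓ∞(X*)`. -/
def l1dual (X : Type) [NormedAddCommGroup X] [NormedSpace ℝ X] :
    lp (fun _ : ℕ => X →L[ℝ] ℝ) ∞ ≃L[ℝ] (lp (fun _ : ℕ => X) 1 →L[ℝ] ℝ) :=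
  LinearEquiv.toContinuousLinearEquivOfBounds (l1lin X) ‖l1fwd X‖ 1
    (fun φ => (l1fwd X).le_opNorm φ)
    (fun φ => (norm_l1inv_le φ).trans (one_mul ‖φ‖).ge)

/-- `ℓ∞` of isomorphic spaces. -/
def linftyCongr {Y Z : Type} [NormedAddCommGroup Y] [NormedSpace ℝ Y]
    [NormedAddCommGroup Z] [NormedSpace ℝ Z] (e : Y ≃L[ℝ] Z) :
    lp (fun _ : ℕ => Y) ∞ ≃L[ℝ] lp (fun _ : ℕ => Z) ∞ :=
  ContinuousLinearEquiv.equivOfInverse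
    (lp.mapCLM ∞ (fun _ => (e : Y →L[ℝ] Z)) (norm_nonneg _) (fun _ => le_rfl))
    (lp.mapCLM ∞ (fun _ => (e.symm : Z →L[ℝ] Y)) (norm_nonneg _) (fun _ => le_rfl))
    (fun x => by ext n; exact e.symm_apply_apply _)
    (fun x => by ext n; exact e.apply_symm_apply _)

end L1dual

section LqDual

variable {q q' : ℝ} [Fact (1 ≤ ENNReal.ofReal q)] [Fact (1 ≤ ENNReal.ofReal q')]

theorem dual_sum_le (hc : q.HolderConjugate q') (φ : Lp' (ENNReal.ofReal q') →L[ℝ] ℝ)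
    (s : Finset ℕ) :
    ∑ n ∈ s, ‖φ (lp.single _ n 1)‖ ^ q ≤ ‖φ‖ ^ q := by
  have hq : 0 < q := hc.pos
  have hq' : 0 < q' := hc.symm.pos
  set a : ℕ → ℝ := fun n => φ (lp.single _ n 1) with ha
  set S : ℝ := ∑ n ∈ s, ‖a n‖ ^ q with hS
  change S ≤ _
  have hS0 : 0 ≤ S := Finset.sum_nonneg fun _ _ => by positivity
  rcases hS0.eq_or_lt with h0 | hpos
  · rw [← h0]; positivity
  let c : ℕ → ℝ := fun n => SignType.sign (a n) * ‖a n‖ ^ (q - 1)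
  let x : Lp' (ENNReal.ofReal q') := ∑ n ∈ s, lp.single _ n (c n)
  have hq1 : 0 < q - 1 := hc.sub_one_pos
  have hc1 : ∀ n, ‖c n‖ ^ q' = ‖a n‖ ^ q := by
    intro n
    rcases eq_or_ne (a n) 0 with h | h
    · simp [c, h, Real.zero_rpow hq.ne', Real.zero_rpow hq'.ne']
    · have : ‖c n‖ = ‖a n‖ ^ (q - 1) := by
        simp only [c, norm_mul]
        rw [Real.norm_of_nonneg (Real.rpow_nonneg (norm_nonneg (a n)) _)]
        rcases h.lt_or_gt with h | h <;> simp [h]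
      rw [this, ← Real.rpow_mul (norm_nonneg _), hc.sub_one_mul_conj]
  have hφ : φ x = S := by
    simp only [x, map_sum, hS]
    refine Finset.sum_congr rfl fun n _ => ?_
    have : (lp.single (ENNReal.ofReal q') n (c n) : Lp' (ENNReal.ofReal q')) =
        c n • lp.single _ n (1 : ℝ) := by
      rw [← lp.single_smul]; simp
    rw [this, map_smul, smul_eq_mul]
    change c n * a n = _
    rcases eq_or_ne (a n) 0 with h | h
    · simp [h, Real.zero_rpow hq.ne']
    · have h2 : ‖a n‖ ^ q = ‖a n‖ ^ (q - 1) * ‖a n‖ := by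
        rw [Real.rpow_sub_one (norm_ne_zero_iff.2 h)]
        field_simp
      rw [h2]
      simp only [c]
      rw [mul_right_comm, sign_mul_self, mul_comm, Real.norm_eq_abs]
  have hx : ‖x‖ ^ q' = S := by
    have := lp.norm_sum_single (p := ENNReal.ofReal q') (E := fun _ : ℕ => ℝ) (by rwa [toReal_rho]) c s
    rw [toReal_rho] at this
    rw [this]
    exact Finset.sum_congr rfl fun n _ => hc1 n
  have hx' : ‖x‖ = S ^ (1 / q') := by
    rw [← hx, one_div, Real.rpow_rpow_inv (norm_nonneg _) hq'.ne']
  have h1 : S ≤ ‖φ‖ * S ^ (1 / q') := by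
    rw [← hx']
    calc S = φ x := hφ.symm
      _ ≤ ‖φ x‖ := le_abs_self _
      _ ≤ _ := φ.le_opNorm x
  have h2 : S ^ (1 / q) ≤ ‖φ‖ := by
    have h3 : S = S ^ (1 / q) * S ^ (1 / q') := by
      rw [← Real.rpow_add hpos, one_div, one_div, hc.inv_add_inv_eq_one, Real.rpow_one]
    have h4 : 0 < S ^ (1 / q') := Real.rpow_pos_of_pos hpos _
    nth_rewrite 1 [h3] at h1
    exact le_of_mul_le_mul_right h1 h4
  rw [one_div] at h2
  exact (Real.rpow_inv_le_iff_of_pos hS0 (norm_nonneg _) hq).1 h2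

/-- The pairing map `ℓ_q → (ℓ_{q'})*`. -/
def lqFwd (hc : q.HolderConjugate q') :
    Lp' (ENNReal.ofReal q) →L[ℝ] (Lp' (ENNReal.ofReal q') →L[ℝ] ℝ) :=
  haveI := hc.ennrealOfReal
  lp.dualPairing (ENNReal.ofReal q) (ENNReal.ofReal q')
          (fun _ : ℕ => ContinuousLinearMap.mul ℝ ℝ) (K := 1) (fun _ => by simp)

theorem lqFwd_apply (hc : q.HolderConjugate q') (x : Lp' (ENNReal.ofReal q))
    (y : Lp' (ENNReal.ofReal q')) : lqFwd hc x y = ∑' k, x k * y k := rfl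

/-- The inverse map. -/
def lqInv (hc : q.HolderConjugate q') (φ : Lp' (ENNReal.ofReal q') →L[ℝ] ℝ) :
    Lp' (ENNReal.ofReal q) :=
  ⟨fun n => φ (lp.single _ n 1), memℓp_gen' (C := ‖φ‖ ^ q) (fun s => by
        rw [toReal_rho]
        exact dual_sum_le hc φ s)⟩

theorem lqInv_apply (hc : q.HolderConjugate q') (φ : Lp' (ENNReal.ofReal q') →L[ℝ] ℝ) (n : ℕ) :
    lqInv hc φ n = φ (lp.single _ n 1) := rfl

theorem norm_lqInv_le (hc : q.HolderConjugate q') (φ : Lp' (ENNReal.ofReal q') →L[ℝ] ℝ) :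
    ‖lqInv hc φ‖ ≤ ‖φ‖ := by
  have hr : (ENNReal.ofReal q).toReal = q := toReal_rho q
  refine lp.norm_le_of_forall_sum_le (hr.symm ▸ hc.pos) (norm_nonneg _) fun s => ?_
  simp only [lqInv_apply, hr]
  exact dual_sum_le hc φ s

theorem lq_left_inv (hc : q.HolderConjugate q') (x : Lp' (ENNReal.ofReal q)) :
    lqInv hc (lqFwd hc x) = x := by
  refine lp.ext (funext fun n => ?_)
  rw [lqInv_apply, lqFwd_apply, tsum_eq_single n]
  · rw [lp.single_apply_self, mul_one]
  · intro k hk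
    rw [lp.single_apply_ne _ _ _ hk, mul_zero]

theorem lq_right_inv (hc : q.HolderConjugate q') (φ : Lp' (ENNReal.ofReal q') →L[ℝ] ℝ) :
    lqFwd hc (lqInv hc φ) = φ := by
  refine lp.ext_continuousLinearMap ENNReal.ofReal_ne_top fun n => ?_
  ext
  change lqFwd hc (lqInv hc φ) (lp.single _ n 1) = φ (lp.single _ n 1)
  rw [lqFwd_apply, tsum_eq_single n]
  · rw [lp.single_apply_self, lqInv_apply, mul_one]
  · intro k hk
    rw [lp.single_apply_ne _ _ _ hk, mul_zero]

/-- Algebraic version. -/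
def lqLin (hc : q.HolderConjugate q') :
    Lp' (ENNReal.ofReal q) ≃ₗ[ℝ] (Lp' (ENNReal.ofReal q') →L[ℝ] ℝ) where
  toFun := lqFwd hc
  map_add' := map_add (lqFwd hc)
  map_smul' := map_smul (lqFwd hc)
  invFun := lqInv hc
  left_inv := lq_left_inv hc
  right_inv := lq_right_inv hc

/-- `ℓ_q ≅ (ℓ_{q'})*`. -/
def lqDual (hc : q.HolderConjugate q') :
    Lp' (ENNReal.ofReal q) ≃L[ℝ] (Lp' (ENNReal.ofReal q') →L[ℝ] ℝ) :=
  LinearEquiv.toContinuousLinearEquivOfBounds (lqLin hc) ‖lqFwd hc‖ 1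
    (fun φ => (lqFwd hc).le_opNorm φ)
    (fun φ => (norm_lqInv_le hc φ).trans (one_mul ‖φ‖).ge)

end LqDual
/-- Let `1 < p ≤ q < ∞` and `1/q + 1/q' = 1`. Then `ℓ_p ⊗̂ ℓ_{q'}` is
isomorphic to the `ℓ₁`-sum of countably many copies of itself, and consequently
`B(ℓ_p, ℓ_q) ≅ (ℓ_p ⊗̂ ℓ_{q'})*` is isomorphic to the `ℓ∞`-sum of countably many copies of
itself. -/
theorem stmt5 (p q q' : ℝ) (hp : 1 < p) (hpq : p ≤ q) (hq' : 1 / q + 1 / q' = 1)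
    [Fact (1 ≤ ENNReal.ofReal p)] [Fact (1 ≤ ENNReal.ofReal q)]
    [Fact (1 ≤ ENNReal.ofReal q')] :
    IsoBanach (LpT ![p, q']) (lp (fun _ : ℕ => LpT ![p, q']) 1) ∧
    IsoBanach (LpT ![p, q'] →L[ℝ] ℝ) (Lp' (ENNReal.ofReal p) →L[ℝ] Lp' (ENNReal.ofReal q)) ∧
    IsoBanach (Lp' (ENNReal.ofReal p) →L[ℝ] Lp' (ENNReal.ofReal q))
      (lp (fun _ : ℕ => Lp' (ENNReal.ofReal p) →L[ℝ] Lp' (ENNReal.ofReal q)) ∞) := by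
  have hq : 1 < q := hp.trans_le hpq
  have hc : q.HolderConjugate q' := by
    rw [Real.holderConjugate_iff]
    exact ⟨hq, by simpa [one_div] using hq'⟩
  have h1 : Nonempty (LpT ![p, q'] ≃L[ℝ] lp (fun _ : ℕ => LpT ![p, q']) 1) :=
    iso1 ![p, q'] (q := q) hpq hc
  have h2 : Nonempty ((LpT ![p, q'] →L[ℝ] ℝ) ≃L[ℝ]
      (Lp' (ENNReal.ofReal p) →L[ℝ] Lp' (ENNReal.ofReal q))) :=
    ⟨(dualIso (fun i => Lp' (ENNReal.ofReal (![p, q'] i)))).trans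
      (ContinuousLinearEquiv.arrowCongr (.refl ℝ (Lp' (ENNReal.ofReal p))) (lqDual hc).symm)⟩
  refine ⟨h1, h2, ?_⟩
  obtain ⟨e1⟩ := h1
  obtain ⟨e2⟩ := h2
  exact ⟨e2.symm.trans <| (ContinuousLinearEquiv.arrowCongr e1 (.refl ℝ ℝ)).trans <|
    (l1dual _).symm.trans (linftyCongr e2)⟩
end
end
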